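/- arXiv:math/9805132 — 4 statements merged into one kernel-verified Lean document; each statement's English description precedes it below -/
import Mathlib

section
/- Let E be a 2n-dimensional F_2-vector space with nondegenerate hyperbolic quadratic form q, and let D : O(E) → Z/2Z be the Dickson invariant. The kernel of D has exactly two orbits on the set of maximal isotropic subspaces of E, and two maximal isotropic subspaces F_1, F_2 lie in the same orbit of ker(D) if and only if dim(F_1 ∩ F_2) ≡ n (mod 2). -/
open Module

/-- The hyperbolic quadratic form on `F₂^n ⊕ F₂^n`. -/
def hypq (n : ℕ) (x : (Fin n ⊕ Fin n) → ZMod 2) : ZMod 2 :=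
  ∑ j : Fin n, x (Sum.inl j) * x (Sum.inr j)

def IsIsotropic (n : ℕ) (F : Submodule (ZMod 2) ((Fin n ⊕ Fin n) → ZMod 2)) : Prop :=
  ∀ x ∈ F, hypq n x = 0

def IsMaxIsotropic (n : ℕ) (F : Submodule (ZMod 2) ((Fin n ⊕ Fin n) → ZMod 2)) : Prop :=
  IsIsotropic n F ∧ ∀ F', IsIsotropic n F' → F ≤ F' → F' = F

/-- The Dickson invariant of a linear endomorphism of an `F₂`-vector space:
the rank of `g - 1` reduced modulo 2. -/
noncomputable def dickson {E : Type*} [AddCommGroup E] [Module (ZMod 2) E]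
    (g : E →ₗ[ZMod 2] E) : ZMod 2 :=
  (Module.finrank (ZMod 2) (LinearMap.range (g - LinearMap.id)) : ZMod 2)

/-- Two maximal isotropic subspaces lie in the same orbit of the kernel of the
Dickson invariant. -/
def SameOrbit (n : ℕ) (F₁ F₂ : Submodule (ZMod 2) ((Fin n ⊕ Fin n) → ZMod 2)) : Prop :=
  ∃ g : ((Fin n ⊕ Fin n) → ZMod 2) ≃ₗ[ZMod 2] ((Fin n ⊕ Fin n) → ZMod 2),
    (∀ x, hypq n (g x) = hypq n x) ∧
    dickson (g : ((Fin n ⊕ Fin n) → ZMod 2) →ₗ[ZMod 2] _) = 0 ∧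
    Submodule.map (g : ((Fin n ⊕ Fin n) → ZMod 2) →ₗ[ZMod 2] _) F₁ = F₂

set_option linter.unusedSectionVars false

section DicksonHelpers

variable {V : Type*} [AddCommGroup V] [Module (ZMod 2) V] [FiniteDimensional (ZMod 2) V]

theorem zmod2_cases (c : ZMod 2) : c = 0 ∨ c = 1 := by
  revert c; decide

theorem zmod2_add_self (c : ZMod 2) : c + c = 0 := by
  revert c; decide

theorem zmod2_eq_of_add (c d : ZMod 2) (h : c + d = 0) : c = d := by
  revert c d; decide

theorem finrank_map_add_inf_ker (f : V →ₗ[ZMod 2] V) (p : Submodule (ZMod 2) V) :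
    finrank (ZMod 2) (p.map f) + finrank (ZMod 2) (p ⊓ LinearMap.ker f : Submodule (ZMod 2) V)
      = finrank (ZMod 2) p := by
  have h := (f.domRestrict p).finrank_range_add_finrank_ker
  rw [LinearMap.range_domRestrict, LinearMap.ker_domRestrict] at h
  rw [← h, ← Submodule.finrank_map_subtype_eq p,
    Submodule.map_comap_subtype]

theorem finrank_inf_ker_add_one (f : V →ₗ[ZMod 2] ZMod 2) (W : Submodule (ZMod 2) V)
    (w : V) (hw : w ∈ W) (hf : f w ≠ 0) :
    finrank (ZMod 2) W
      = finrank (ZMod 2) (W ⊓ LinearMap.ker f : Submodule (ZMod 2) V) + 1 := by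
  have h := (f.domRestrict W).finrank_range_add_finrank_ker
  have hs : LinearMap.range (f.domRestrict W) = ⊤ := by
    apply LinearMap.range_eq_top.2
    apply LinearMap.surjective
    intro h0
    apply hf
    have := LinearMap.congr_fun h0 ⟨w, hw⟩
    simpa using this
  rw [hs, LinearMap.ker_domRestrict, finrank_top, finrank_self] at h
  rw [← h, ← Submodule.finrank_map_subtype_eq W,
    Submodule.map_comap_subtype]
  omega

/-- An alternating form has even rank. -/
theorem alt_even_rank (A : LinearMap.BilinForm (ZMod 2) V) (m : ℕ) :
    ∀ W : Submodule (ZMod 2) V, finrank (ZMod 2) W = m → (∀ w ∈ W, A w w = 0) →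
    ∃ k, finrank (ZMod 2) W
      = finrank (ZMod 2) (W ⊓ A.orthogonal W : Submodule (ZMod 2) V) + 2 * k := by
  induction m using Nat.strong_induction_on with
  | _ m ih =>
  intro W hm hA
  have hsymm : ∀ x ∈ W, ∀ y ∈ W, A x y = A y x := by
    intro x hx y hy
    have h := hA (x + y) (W.add_mem hx hy)
    simp only [map_add, LinearMap.add_apply, hA x hx, hA y hy, zero_add, add_zero] at h
    apply zmod2_eq_of_add
    rw [add_comm] at h
    exact h
  by_cases hall : ∀ a ∈ W, ∀ b ∈ W, A a b = 0
  · refine ⟨0, ?_⟩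
    have : W ⊓ A.orthogonal W = W := by
      apply inf_eq_left.2
      intro x hx
      rw [LinearMap.BilinForm.mem_orthogonal_iff]
      intro y hy
      exact hall y hy x hx
    rw [this]; simp
  · push Not at hall
    obtain ⟨a, ha, b, hb, hab⟩ := hall
    have hab1 : A a b = 1 := (zmod2_cases _).resolve_left hab
    have hba1 : A b a = 1 := by rw [hsymm b hb a ha, hab1]
    have e1 := finrank_inf_ker_add_one (A a) W b hb hab
    have e2 := finrank_inf_ker_add_one (A b) (W ⊓ LinearMap.ker (A a)) a
      ⟨ha, by simpa using hA a ha⟩ (by rw [hba1]; exact one_ne_zero)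
    set W' := W ⊓ LinearMap.ker (A a) ⊓ LinearMap.ker (A b) with hW'
    have hmem : ∀ x, x ∈ W' ↔ x ∈ W ∧ A a x = 0 ∧ A b x = 0 := by
      intro x
      simp [hW', and_assoc]
    obtain ⟨k, hk⟩ := ih (finrank (ZMod 2) W') (by omega) W' rfl
      (fun w hw => hA w ((hmem w).1 hw).1)
    refine ⟨k + 1, ?_⟩
    have hR : W' ⊓ A.orthogonal W' = W ⊓ A.orthogonal W := by
      ext w
      simp only [Submodule.mem_inf, hmem, LinearMap.BilinForm.mem_orthogonal_iff]
      constructor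
      · rintro ⟨⟨hw, haw, hbw⟩, ho⟩
        refine ⟨hw, fun x hx => ?_⟩
        have hx' := ho (x + A b x • a + A a x • b) ⟨?_, ?_, ?_⟩
        · simpa [haw, hbw] using hx'
        · exact W.add_mem (W.add_mem hx (W.smul_mem _ ha)) (W.smul_mem _ hb)
        · simp [hA a ha, hab1, zmod2_add_self]
        · simp [hA b hb, hba1, zmod2_add_self]
      · rintro ⟨hw, ho⟩
        exact ⟨⟨hw, ho a ha, ho b hb⟩, fun x hx => ho x hx.1⟩
    rw [hR] at hk
    omega

variable (q : V → ZMod 2) (B : LinearMap.BilinForm (ZMod 2) V)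

theorem pol_symm (hq : ∀ x y, q (x + y) = q x + q y + B x y) (x y : V) : B x y = B y x := by
  have h1 := hq x y
  have h2 := hq y x
  rw [add_comm y x] at h2
  have h3 : q x + q y + B x y = q x + q y + B y x := by
    rw [← h1, h2]; ring
  exact add_left_cancel h3

theorem pol_zero (hq : ∀ x y, q (x + y) = q x + q y + B x y) : q 0 = 0 := by
  have := hq 0 0
  simpa using this

theorem pol_self (hq : ∀ x y, q (x + y) = q x + q y + B x y) (x : V) : B x x = 0 := by
  have := hq x x
  rw [ZModModule.add_self, pol_zero q B hq, zmod2_add_self, zero_add] at this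
  exact this.symm

theorem pol_refl (hq : ∀ x y, q (x + y) = q x + q y + B x y) : B.IsRefl := by
  intro x y h
  rw [pol_symm q B hq]; exact h

/-- Lagrangian subspaces: isotropic and of half dimension. -/
def Lag (q : V → ZMod 2) (F : Submodule (ZMod 2) V) : Prop :=
  (∀ x ∈ F, q x = 0) ∧ finrank (ZMod 2) V = 2 * finrank (ZMod 2) F

theorem iso_pol (hq : ∀ x y, q (x + y) = q x + q y + B x y) {F : Submodule (ZMod 2) V}
    (hF : ∀ x ∈ F, q x = 0) (x y : V) (hx : x ∈ F) (hy : y ∈ F) : B x y = 0 := by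
  have := hq x y
  rw [hF x hx, hF y hy, hF _ (F.add_mem hx hy)] at this
  simpa using this.symm

theorem iso_le_orth (hq : ∀ x y, q (x + y) = q x + q y + B x y) {F : Submodule (ZMod 2) V}
    (hF : ∀ x ∈ F, q x = 0) : F ≤ B.orthogonal F := by
  intro x hx
  rw [LinearMap.BilinForm.mem_orthogonal_iff]
  intro y hy
  exact iso_pol q B hq hF y x hy hx

theorem finrank_orth_add (hB : B.Nondegenerate) (F : Submodule (ZMod 2) V) :
    finrank (ZMod 2) (B.orthogonal F) + finrank (ZMod 2) F = finrank (ZMod 2) V := by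
  have h := LinearMap.BilinForm.finrank_orthogonal hB F
  have := Submodule.finrank_le F
  omega

theorem Lag.orth (hq : ∀ x y, q (x + y) = q x + q y + B x y) (hB : B.Nondegenerate)
    {F : Submodule (ZMod 2) V} (hF : Lag q F) : B.orthogonal F = F := by
  symm
  apply Submodule.eq_of_le_of_finrank_eq (iso_le_orth q B hq hF.1)
  have := finrank_orth_add B hB F
  have := hF.2
  omega

theorem Lag.map (g : V ≃ₗ[ZMod 2] V) (hg : ∀ x, q (g x) = q x)
    {F : Submodule (ZMod 2) V} (hF : Lag q F) : Lag q (F.map (g : V →ₗ[ZMod 2] V)) := by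
  refine ⟨?_, ?_⟩
  · rintro _ ⟨x, hx, rfl⟩
    have := hg x
    rw [hF.1 x hx] at this
    exact this
  · rw [LinearEquiv.finrank_map_eq]; exact hF.2

theorem orth_sup (X Y : Submodule (ZMod 2) V) :
    B.orthogonal (X ⊔ Y) = B.orthogonal X ⊓ B.orthogonal Y := by
  apply le_antisymm
  · exact le_inf (LinearMap.BilinForm.orthogonal_le le_sup_left)
      (LinearMap.BilinForm.orthogonal_le le_sup_right)
  · rintro m ⟨h1, h2⟩
    rw [LinearMap.BilinForm.mem_orthogonal_iff]
    intro z hz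
    obtain ⟨x, hx, y, hy, rfl⟩ := Submodule.mem_sup.1 hz
    have h1' : B x m = 0 := h1 x hx
    have h2' : B y m = 0 := h2 y hy
    simp [h1', h2']

theorem iso_B (hq : ∀ x y, q (x + y) = q x + q y + B x y) (g : V ≃ₗ[ZMod 2] V)
    (hg : ∀ x, q (g x) = q x) (x y : V) : B (g x) (g y) = B x y := by
  have h1 := hq (g x) (g y)
  rw [← map_add, hg, hg, hg, hq] at h1
  exact (add_left_cancel h1).symm

/-- The key parity formula. -/
theorem rank_parity (hq : ∀ x y, q (x + y) = q x + q y + B x y) (hB : B.Nondegenerate)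
    (g : V ≃ₗ[ZMod 2] V) (hg : ∀ x, q (g x) = q x)
    {F : Submodule (ZMod 2) V} (hF : Lag q F) :
    (finrank (ZMod 2) (LinearMap.range ((g : V →ₗ[ZMod 2] V) - LinearMap.id))
      + finrank (ZMod 2) (F ⊓ F.map (g : V →ₗ[ZMod 2] V) : Submodule (ZMod 2) V)) % 2
      = finrank (ZMod 2) F % 2 := by
  set h : V →ₗ[ZMod 2] V := (g : V →ₗ[ZMod 2] V) - LinearMap.id with hh
  have happ : ∀ x, h x = g x - x := fun x => by simp [hh]
  have hrefl := pol_refl q B hq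
  have horth := hF.orth q B hq hB
  set K := F.comap h with hK
  have hkerK : LinearMap.ker h ≤ K := by
    intro x hx
    rw [LinearMap.mem_ker] at hx
    rw [hK, Submodule.mem_comap, hx]
    exact F.zero_mem
  have e1 := finrank_map_add_inf_ker h F
  have e2 : finrank (ZMod 2) (F ⊓ F.map (g : V →ₗ[ZMod 2] V) : Submodule (ZMod 2) V)
      = finrank (ZMod 2) (F ⊓ K : Submodule (ZMod 2) V) := by
    rw [← LinearEquiv.finrank_map_eq g (F ⊓ K)]
    suffices hs : F ⊓ F.map (g : V →ₗ[ZMod 2] V) = (F ⊓ K).map (g : V →ₗ[ZMod 2] V) by rw [hs]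
    ext y
    constructor
    · rintro ⟨hy, x, hx, rfl⟩
      refine ⟨x, ⟨hx, ?_⟩, rfl⟩
      change h x ∈ F
      rw [happ]
      exact F.sub_mem hy hx
    · rintro ⟨x, ⟨hx, hx'⟩, rfl⟩
      refine ⟨?_, x, hx, rfl⟩
      have h2 : h x ∈ F := hx'
      rw [happ] at h2
      have := F.add_mem h2 hx
      simpa using this
  have e4 := h.finrank_range_add_finrank_ker
  have e5 : finrank (ZMod 2) K + finrank (ZMod 2) (F.map h) = finrank (ZMod 2) V := by
    have hKo : K = B.orthogonal ((F.map h).map (g.symm : V →ₗ[ZMod 2] V)) := by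
      have key : ∀ v u, B (g.symm (h v)) u = - B v (h u) := by
        intro v u
        have h1 := iso_B q B hq g hg (g.symm v) u
        rw [LinearEquiv.apply_symm_apply] at h1
        rw [happ, happ, map_sub, LinearEquiv.symm_apply_apply, map_sub, map_sub,
          LinearMap.sub_apply, h1]
        ring
      ext u
      rw [hK, Submodule.mem_comap]
      conv_lhs => rw [← horth]
      rw [LinearMap.BilinForm.mem_orthogonal_iff, LinearMap.BilinForm.mem_orthogonal_iff]
      constructor
      · rintro ho _ ⟨_, ⟨v, hv, rfl⟩, rfl⟩
        have h1 : B v (h u) = 0 := ho v hv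
        have h2 := key v u
        rw [h1, neg_zero] at h2
        exact h2
      · intro ho v hv
        have h1 : B (g.symm (h v)) u = 0 := ho _ ⟨_, ⟨v, hv, rfl⟩, rfl⟩
        rw [key] at h1
        exact neg_eq_zero.1 h1
    have h3 := finrank_orth_add B hB ((F.map h).map (g.symm : V →ₗ[ZMod 2] V))
    rw [← hKo, LinearEquiv.finrank_map_eq] at h3
    exact h3
  obtain ⟨k, e6⟩ := alt_even_rank (B ∘ₗ h) _ K rfl (by
    intro u hu
    have h1 : h u ∈ F := hu
    have h2 := hF.1 _ h1
    have h3 := hq (h u) u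
    have h4 : h u + u = g u := by rw [happ]; abel
    rw [h4, hg, h2] at h3
    simpa using h3.symm)
  have e7 : K ⊓ LinearMap.BilinForm.orthogonal (B ∘ₗ h) K = LinearMap.ker h ⊔ (F ⊓ K) := by
    have a1 : LinearMap.BilinForm.orthogonal (B ∘ₗ h) K = B.orthogonal (K.map h) := by
      ext v
      rw [LinearMap.BilinForm.mem_orthogonal_iff, LinearMap.BilinForm.mem_orthogonal_iff]
      constructor
      · rintro ho _ ⟨u, hu, rfl⟩
        exact ho u hu
      · intro ho u hu
        exact ho _ ⟨u, hu, rfl⟩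
    have a2 : B.orthogonal (LinearMap.range h) = LinearMap.ker h := by
      have key : ∀ u v, B (h u) v = - B (g u) (h v) := by
        intro u v
        rw [happ, happ, map_sub, map_sub, LinearMap.sub_apply, iso_B q B hq g hg]
        ring
      ext v
      rw [LinearMap.BilinForm.mem_orthogonal_iff, LinearMap.mem_ker]
      constructor
      · intro ho
        apply hB.2
        intro x
        have h1 : B (h (g.symm x)) v = 0 := ho _ ⟨_, rfl⟩
        rw [key, LinearEquiv.apply_symm_apply] at h1
        exact neg_eq_zero.1 h1
      · rintro hv _ ⟨u, rfl⟩
        rw [key, hv]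
        simp
    have a3 : B.orthogonal (K.map h) = LinearMap.ker h ⊔ F := by
      rw [← LinearMap.BilinForm.orthogonal_orthogonal hB hrefl (LinearMap.ker h ⊔ F),
        orth_sup, horth, ← a2, LinearMap.BilinForm.orthogonal_orthogonal hB hrefl,
        hK, Submodule.map_comap_eq]
    rw [a1, a3, inf_comm, sup_inf_assoc_of_le _ hkerK]
  rw [e7] at e6
  have e8 := Submodule.finrank_sup_add_finrank_inf_eq (LinearMap.ker h) (F ⊓ K)
  have e9 : LinearMap.ker h ⊓ (F ⊓ K) = F ⊓ LinearMap.ker h := by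
    rw [inf_comm F K, ← inf_assoc, inf_eq_left.2 hkerK, inf_comm]
  rw [e9] at e8
  have e10 := hF.2
  omega

/-- The transvection at `a`. -/
def trv (a : V) (ha : B a a = 0) : V ≃ₗ[ZMod 2] V :=
  LinearEquiv.ofInvolutive (LinearMap.id + (B a).smulRight a) (by
    intro x
    have : B a x • a + B a x • a = 0 := ZModModule.add_self _
    simp [ha, add_assoc, this])

theorem trv_apply (a : V) (ha : B a a = 0) (x : V) : trv B a ha x = x + B a x • a := rfl

theorem trv_iso (hq : ∀ x y, q (x + y) = q x + q y + B x y) (a : V) (ha : B a a = 0)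
    (hqa : q a = 1) (x : V) : q (trv B a ha x) = q x := by
  rw [trv_apply]
  rcases zmod2_cases (B a x) with h | h
  · simp [h]
  · rw [h, one_smul, hq, hqa, pol_symm q B hq, h, add_assoc, zmod2_add_self, add_zero]

theorem lag_transitive (hq : ∀ x y, q (x + y) = q x + q y + B x y) (hB : B.Nondegenerate)
    (m : ℕ) : ∀ F₁ F₂ : Submodule (ZMod 2) V, Lag q F₁ → Lag q F₂ →
    finrank (ZMod 2) V - finrank (ZMod 2) (F₁ ⊓ F₂ : Submodule (ZMod 2) V) = m →
    ∃ g : V ≃ₗ[ZMod 2] V, (∀ x, q (g x) = q x) ∧ F₁.map (g : V →ₗ[ZMod 2] V) = F₂ := by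
  induction m using Nat.strong_induction_on with
  | _ m ih =>
  intro F₁ F₂ h1 h2 hm
  by_cases hle : F₁ ≤ F₂
  · refine ⟨LinearEquiv.refl _ _, fun x => rfl, ?_⟩
    have : F₁ = F₂ := Submodule.eq_of_le_of_finrank_eq hle (by have := h1.2; have := h2.2; omega)
    rw [← this]
    exact Submodule.map_id _
  · obtain ⟨u, hu, hu2⟩ := SetLike.not_le_iff_exists.1 hle
    rw [← h2.orth q B hq hB, LinearMap.BilinForm.mem_orthogonal_iff] at hu2
    push Not at hu2
    obtain ⟨v, hv, hvu⟩ := hu2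
    have hvu1 : B v u = 1 := (zmod2_cases _).resolve_left hvu
    have huv1 : B u v = 1 := by rw [pol_symm q B hq, hvu1]
    have haa := pol_self q B hq (u + v)
    have hqa : q (u + v) = 1 := by rw [hq, h1.1 u hu, h2.1 v hv, huv1]; simp
    have ht := trv_iso q B hq (u + v) haa hqa
    set t := trv B (u + v) haa with htdef
    have htu : t u = v := by
      rw [htdef, trv_apply, map_add, LinearMap.add_apply, pol_self q B hq, hvu1, zero_add,
        one_smul, ← add_assoc, ZModModule.add_self, zero_add]
    have hlt : F₁ ⊓ F₂ < F₁.map (t : V →ₗ[ZMod 2] V) ⊓ F₂ := by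
      apply lt_of_le_of_ne
      · rintro x ⟨hx1, hx2⟩
        refine ⟨⟨x, hx1, ?_⟩, hx2⟩
        change t x = x
        rw [htdef, trv_apply, map_add, LinearMap.add_apply, iso_pol q B hq h1.1 u x hu hx1,
          iso_pol q B hq h2.1 v x hv hx2]
        simp
      · intro heq
        have : v ∈ F₁ ⊓ F₂ := by
          rw [heq]
          exact ⟨⟨u, hu, htu⟩, hv⟩
        have h0 := iso_pol q B hq h1.1 u v hu this.1
        rw [huv1] at h0
        exact one_ne_zero h0
    have hfl := Submodule.finrank_lt_finrank_of_lt hlt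
    have hfl2 := Submodule.finrank_le (F₁.map (t : V →ₗ[ZMod 2] V) ⊓ F₂)
    obtain ⟨g, hg, hgF⟩ := ih _ (by omega) (F₁.map (t : V →ₗ[ZMod 2] V)) F₂
      (h1.map q t ht) h2 rfl
    refine ⟨t.trans g, fun x => ?_, ?_⟩
    · rw [LinearEquiv.trans_apply, hg, ht]
    · rw [← hgF, ← Submodule.map_comp]
      rfl

/-- A transvection switches the parity. -/
theorem trv_parity (hq : ∀ x y, q (x + y) = q x + q y + B x y) (hB : B.Nondegenerate)
    (a : V) (ha : B a a = 0) (hqa : q a = 1) {M N : Submodule (ZMod 2) V}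
    (hM : Lag q M) (hN : Lag q N) :
    finrank (ZMod 2) (N ⊓ M : Submodule (ZMod 2) V)
      = finrank (ZMod 2) (N ⊓ M.map (trv B a ha : V →ₗ[ZMod 2] V) : Submodule (ZMod 2) V) + 1 ∨
    finrank (ZMod 2) (N ⊓ M.map (trv B a ha : V →ₗ[ZMod 2] V) : Submodule (ZMod 2) V)
      = finrank (ZMod 2) (N ⊓ M : Submodule (ZMod 2) V) + 1 := by
  have hrefl := pol_refl q B hq
  set M' := M.map (trv B a ha : V →ₗ[ZMod 2] V) with hM'
  set U := M ⊓ LinearMap.ker (B a) with hU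
  have haM : a ∉ M := fun h => by
    have := hM.1 a h
    rw [hqa] at this
    exact one_ne_zero this
  have hex : ∃ w ∈ M, B a w ≠ 0 := by
    by_contra hcon
    push Not at hcon
    apply haM
    rw [← hM.orth q B hq hB, LinearMap.BilinForm.mem_orthogonal_iff]
    intro w hw
    rw [pol_symm q B hq]
    exact hcon w hw
  obtain ⟨w, hw, haw⟩ := hex
  have f1 := finrank_inf_ker_add_one (B a) M w hw haw
  rw [← hU] at f1
  have hUM' : M ⊓ M' = U := by
    ext x
    constructor
    · rintro ⟨hx, y, hy, hyx⟩
      refine ⟨hx, ?_⟩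
      change trv B a ha y = x at hyx
      rw [trv_apply] at hyx
      rcases zmod2_cases (B a y) with h | h
      · rw [h, zero_smul, add_zero] at hyx
        change B a x = 0
        rw [← hyx, h]
      · exfalso
        apply haM
        rw [h, one_smul] at hyx
        have : a = x - y := by rw [← hyx]; abel
        rw [this]
        exact M.sub_mem hx hy
    · rintro ⟨hx, hx0⟩
      change B a x = 0 at hx0
      refine ⟨hx, x, hx, ?_⟩
      change trv B a ha x = x
      rw [trv_apply, hx0, zero_smul, add_zero]
  have hUo : B.orthogonal U = M ⊔ Submodule.span (ZMod 2) {a} := by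
    rw [← LinearMap.BilinForm.orthogonal_orthogonal hB hrefl (M ⊔ Submodule.span (ZMod 2) {a}),
      orth_sup, hM.orth q B hq hB]
    suffices hs : LinearMap.ker (B a) = B.orthogonal (Submodule.span (ZMod 2) {a}) by
      rw [hU, hs]
    ext x
    rw [LinearMap.mem_ker, LinearMap.BilinForm.mem_orthogonal_iff]
    constructor
    · intro hx z hz
      obtain ⟨c, rfl⟩ := Submodule.mem_span_singleton.1 hz
      simp [hx]
    · intro h
      exact h a (Submodule.mem_span_singleton_self a)
  set X := N ⊓ B.orthogonal U with hX
  have f2 : finrank (ZMod 2) X = finrank (ZMod 2) (N ⊓ U : Submodule (ZMod 2) V) + 1 := by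
    have x1 : X = B.orthogonal (N ⊔ U) := by rw [orth_sup, hN.orth q B hq hB]
    have x2 := finrank_orth_add B hB (N ⊔ U)
    rw [← x1] at x2
    have x3 := Submodule.finrank_sup_add_finrank_inf_eq N U
    have := hM.2
    have := hN.2
    omega
  have hMX : N ⊓ M ≤ X := by
    rw [hX, hUo]
    exact inf_le_inf_left _ le_sup_left
  have hM'X : N ⊓ M' ≤ X := by
    rw [hX, hUo]
    apply inf_le_inf_left
    rintro _ ⟨y, hy, rfl⟩
    exact Submodule.add_mem_sup hy (Submodule.smul_mem _ _ (Submodule.mem_span_singleton_self a))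
  have hun : ∀ x ∈ X, x ∈ N ⊓ M ∨ x ∈ N ⊓ M' := by
    rintro x ⟨hxN, hx⟩
    have hx : x ∈ B.orthogonal U := hx
    rw [hUo] at hx
    obtain ⟨y, hy, z, hz, rfl⟩ := Submodule.mem_sup.1 hx
    obtain ⟨c, rfl⟩ := Submodule.mem_span_singleton.1 hz
    rcases zmod2_cases c with h | h
    · left
      refine ⟨hxN, ?_⟩
      simpa [h] using hy
    · right
      refine ⟨hxN, y, hy, ?_⟩
      subst h
      have h0 := hN.1 _ hxN
      rw [one_smul, hq, hM.1 y hy, hqa, zero_add] at h0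
      have h1 : B a y = 1 := by
        rw [pol_symm q B hq]
        exact (zmod2_eq_of_add _ _ h0).symm
      change trv B a ha y = _
      rw [trv_apply, h1]
  have hor : X ≤ N ⊓ M ∨ X ≤ N ⊓ M' := by
    by_contra hcon
    push Not at hcon
    obtain ⟨hc1, hc2⟩ := hcon
    obtain ⟨x, hx, hx1⟩ := SetLike.not_le_iff_exists.1 hc1
    obtain ⟨y, hy, hy1⟩ := SetLike.not_le_iff_exists.1 hc2
    have hx2 := (hun x hx).resolve_left hx1
    have hy2 := (hun y hy).resolve_right hy1
    rcases hun _ (X.add_mem hx hy) with h | h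
    · apply hx1
      have := Submodule.sub_mem _ h hy2
      simpa using this
    · apply hy1
      have := Submodule.sub_mem _ h hx2
      simpa using this
  rcases hor with h | h
  · left
    have y1 : N ⊓ M = X := le_antisymm hMX h
    have y2 : N ⊓ M' = N ⊓ U := by
      rw [← hUM']
      apply le_antisymm
      · exact le_inf inf_le_left (le_inf ((hM'X.trans h).trans inf_le_right) inf_le_right)
      · exact inf_le_inf_left _ inf_le_right
    rw [y1, y2, f2]
  · right
    have y1 : N ⊓ M' = X := le_antisymm hM'X h
    have y2 : N ⊓ M = N ⊓ U := by
      rw [← hUM']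
      apply le_antisymm
      · exact le_inf inf_le_left (le_inf inf_le_right ((hMX.trans h).trans inf_le_right))
      · exact inf_le_inf_left _ inf_le_left
    rw [y1, y2, f2]

theorem max_lag (hq : ∀ x y, q (x + y) = q x + q y + B x y) (hB : B.Nondegenerate)
    {L F : Submodule (ZMod 2) V} (hL : Lag q L) (hF : ∀ x ∈ F, q x = 0)
    (hmax : ∀ F' : Submodule (ZMod 2) V, (∀ x ∈ F', q x = 0) → F ≤ F' → F' = F) : Lag q F := by
  refine ⟨hF, ?_⟩
  have h1 : F ⊔ (L ⊓ B.orthogonal F) = F := by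
    apply hmax _ _ le_sup_left
    intro x hx
    obtain ⟨y, hy, z, ⟨hz, hz'⟩, rfl⟩ := Submodule.mem_sup.1 hx
    have h0 : B y z = 0 := hz' y hy
    rw [hq, hF y hy, hL.1 z hz, h0]
    simp
  have h2 : L ⊓ B.orthogonal F = L ⊓ F := by
    apply le_antisymm
    · exact le_inf inf_le_left (le_sup_right.trans h1.le)
    · exact inf_le_inf_left _ (iso_le_orth q B hq hF)
  have h3 : L ⊓ B.orthogonal F = B.orthogonal (L ⊔ F) := by
    rw [orth_sup, hL.orth q B hq hB]
  have h4 := finrank_orth_add B hB (L ⊔ F)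
  rw [← h3, h2] at h4
  have h5 := Submodule.finrank_sup_add_finrank_inf_eq L F
  have := hL.2
  omega

theorem lag_max (hq : ∀ x y, q (x + y) = q x + q y + B x y) (hB : B.Nondegenerate)
    {F : Submodule (ZMod 2) V} (hF : Lag q F) (F' : Submodule (ZMod 2) V)
    (hF' : ∀ x ∈ F', q x = 0) (hle : F ≤ F') : F' = F := by
  apply le_antisymm _ hle
  calc F' ≤ B.orthogonal F' := iso_le_orth q B hq hF'
    _ ≤ B.orthogonal F := LinearMap.BilinForm.orthogonal_le hle
    _ = F := hF.orth q B hq hB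

end DicksonHelpers

/-- The polar form of `hypq`. -/
def hypB (n : ℕ) : LinearMap.BilinForm (ZMod 2) ((Fin n ⊕ Fin n) → ZMod 2) :=
  LinearMap.mk₂ (ZMod 2)
    (fun x y => ∑ j : Fin n, (x (Sum.inl j) * y (Sum.inr j) + x (Sum.inr j) * y (Sum.inl j)))
    (by intro x x' y; rw [← Finset.sum_add_distrib]
        refine Finset.sum_congr rfl fun j _ => ?_
        simp only [Pi.add_apply]; ring)
    (by intro c x y; rw [smul_eq_mul, Finset.mul_sum]
        refine Finset.sum_congr rfl fun j _ => ?_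
        simp only [Pi.smul_apply, smul_eq_mul]; ring)
    (by intro x x' y; rw [← Finset.sum_add_distrib]
        refine Finset.sum_congr rfl fun j _ => ?_
        simp only [Pi.add_apply]; ring)
    (by intro c x y; rw [smul_eq_mul, Finset.mul_sum]
        refine Finset.sum_congr rfl fun j _ => ?_
        simp only [Pi.smul_apply, smul_eq_mul]; ring)

theorem hypB_apply (n : ℕ) (x y : (Fin n ⊕ Fin n) → ZMod 2) : hypB n x y =
    ∑ j : Fin n, (x (Sum.inl j) * y (Sum.inr j) + x (Sum.inr j) * y (Sum.inl j)) := rfl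

theorem hyp_pol (n : ℕ) (x y : (Fin n ⊕ Fin n) → ZMod 2) :
    hypq n (x + y) = hypq n x + hypq n y + hypB n x y := by
  rw [hypB_apply, hypq, hypq, hypq, ← Finset.sum_add_distrib, ← Finset.sum_add_distrib]
  refine Finset.sum_congr rfl fun j _ => ?_
  simp only [Pi.add_apply]; ring

theorem hypB_single_inl (n : ℕ) (x : (Fin n ⊕ Fin n) → ZMod 2) (i : Fin n) :
    hypB n x (Pi.single (Sum.inl i) 1) = x (Sum.inr i) := by
  rw [hypB_apply]
  simp [Pi.single_apply]

theorem hypB_single_inr (n : ℕ) (x : (Fin n ⊕ Fin n) → ZMod 2) (i : Fin n) :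
    hypB n x (Pi.single (Sum.inr i) 1) = x (Sum.inl i) := by
  rw [hypB_apply]
  simp [Pi.single_apply]

theorem hypB_nondeg (n : ℕ) : (hypB n).Nondegenerate := by
  have key : ∀ x, (∀ y, hypB n x y = 0) → x = 0 := by
    intro x hx
    funext i
    rcases i with i | i
    · exact (hypB_single_inr n x i).symm.trans (hx _)
    · exact (hypB_single_inl n x i).symm.trans (hx _)
  refine ⟨key, ?_⟩
  intro y hy
  apply key
  intro x
  rw [pol_symm (hypq n) (hypB n) (hyp_pol n)]
  exact hy x

/-- The standard Lagrangian. -/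
def stdL (n : ℕ) : Submodule (ZMod 2) ((Fin n ⊕ Fin n) → ZMod 2) :=
  LinearMap.ker (LinearMap.funLeft (ZMod 2) (ZMod 2) (Sum.inr : Fin n → Fin n ⊕ Fin n))

theorem stdL_lag (n : ℕ) : Lag (hypq n) (stdL n) := by
  refine ⟨?_, ?_⟩
  · intro x hx
    rw [stdL, LinearMap.mem_ker] at hx
    rw [hypq]
    apply Finset.sum_eq_zero
    intro j _
    have : x (Sum.inr j) = 0 := congrFun hx j
    rw [this, mul_zero]
  · have h := (LinearMap.funLeft (ZMod 2) (ZMod 2)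
      (Sum.inr : Fin n → Fin n ⊕ Fin n)).finrank_range_add_finrank_ker
    have hs := LinearMap.range_eq_top.2 (LinearMap.funLeft_surjective_of_injective (ZMod 2) (ZMod 2)
      (Sum.inr : Fin n → Fin n ⊕ Fin n) Sum.inr_injective)
    rw [hs, finrank_top] at h
    simp only [Module.finrank_fintype_fun_eq_card, Fintype.card_sum, Fintype.card_fin] at h ⊢
    rw [stdL]
    omega

theorem hyp_max_iff (n : ℕ) (F : Submodule (ZMod 2) ((Fin n ⊕ Fin n) → ZMod 2)) :
    IsMaxIsotropic n F ↔ Lag (hypq n) F := by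
  constructor
  · rintro ⟨h1, h2⟩
    exact max_lag (hypq n) (hypB n) (hyp_pol n) (hypB_nondeg n) (stdL_lag n) h1 h2
  · intro h
    exact ⟨h.1, lag_max (hypq n) (hypB n) (hyp_pol n) (hypB_nondeg n) h⟩

theorem lag_finrank (n : ℕ) {F : Submodule (ZMod 2) ((Fin n ⊕ Fin n) → ZMod 2)}
    (h : Lag (hypq n) F) : finrank (ZMod 2) F = n := by
  have := h.2
  simp only [Module.finrank_fintype_fun_eq_card, Fintype.card_sum, Fintype.card_fin] at this
  omega

theorem sameOrbit_iff (n : ℕ) (F₁ F₂ : Submodule (ZMod 2) ((Fin n ⊕ Fin n) → ZMod 2))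
    (h1 : Lag (hypq n) F₁) (h2 : Lag (hypq n) F₂) :
    SameOrbit n F₁ F₂ ↔
        Module.finrank (ZMod 2) (F₁ ⊓ F₂ : Submodule (ZMod 2) _) % 2 = n % 2 := by
  have hn := lag_finrank n h1
  have key : ∀ g : ((Fin n ⊕ Fin n) → ZMod 2) ≃ₗ[ZMod 2] ((Fin n ⊕ Fin n) → ZMod 2),
      (∀ x, hypq n (g x) = hypq n x) →
      Submodule.map (g : ((Fin n ⊕ Fin n) → ZMod 2) →ₗ[ZMod 2] _) F₁ = F₂ →
      (dickson (g : ((Fin n ⊕ Fin n) → ZMod 2) →ₗ[ZMod 2] _) = 0 ↔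
        Module.finrank (ZMod 2) (F₁ ⊓ F₂ : Submodule (ZMod 2) _) % 2 = n % 2) := by
    intro g hg hgF
    have hp := rank_parity (hypq n) (hypB n) (hyp_pol n) (hypB_nondeg n) g hg h1
    rw [hgF, hn] at hp
    rw [dickson, ZMod.natCast_eq_zero_iff]
    omega
  constructor
  · rintro ⟨g, hg, hd, hgF⟩
    exact (key g hg hgF).1 hd
  · intro h
    obtain ⟨g, hg, hgF⟩ := lag_transitive (hypq n) (hypB n) (hyp_pol n) (hypB_nondeg n) _
      F₁ F₂ h1 h2 rfl
    exact ⟨g, hg, (key g hg hgF).2 h, hgF⟩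

/-- The kernel of the Dickson invariant has exactly two orbits on the
maximal isotropic subspaces of the hyperbolic `F₂`-space of dimension `2n`, and two
maximal isotropic subspaces `F₁, F₂` lie in the same orbit iff
`dim (F₁ ⊓ F₂) ≡ n (mod 2)`. -/
theorem kernel_dickson_two_orbits (n : ℕ) (hn : 0 < n) :
    (∀ F₁ F₂ : Submodule (ZMod 2) ((Fin n ⊕ Fin n) → ZMod 2),
      IsMaxIsotropic n F₁ → IsMaxIsotropic n F₂ →
      (SameOrbit n F₁ F₂ ↔
        Module.finrank (ZMod 2) (F₁ ⊓ F₂ : Submodule (ZMod 2) _) % 2 = n % 2)) ∧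
    (∃ F₁ F₂ : Submodule (ZMod 2) ((Fin n ⊕ Fin n) → ZMod 2),
      IsMaxIsotropic n F₁ ∧ IsMaxIsotropic n F₂ ∧ ¬ SameOrbit n F₁ F₂ ∧
      ∀ F, IsMaxIsotropic n F → SameOrbit n F F₁ ∨ SameOrbit n F F₂) := by
  refine ⟨fun F₁ F₂ h1 h2 => sameOrbit_iff n F₁ F₂ ((hyp_max_iff n F₁).1 h1)
    ((hyp_max_iff n F₂).1 h2), ?_⟩
  let i0 : Fin n := ⟨0, hn⟩
  let a : (Fin n ⊕ Fin n) → ZMod 2 := Pi.single (Sum.inl i0) 1 + Pi.single (Sum.inr i0) 1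
  have hqa : hypq n a = 1 := by
    simp [hypq, a, Pi.single_apply]
  have haa := pol_self (hypq n) (hypB n) (hyp_pol n) a
  have hL := stdL_lag n
  have hL2 := hL.map (hypq n) (trv (hypB n) a haa)
    (trv_iso (hypq n) (hypB n) (hyp_pol n) a haa hqa)
  have hpar := fun {N} (hN : Lag (hypq n) N) =>
    trv_parity (hypq n) (hypB n) (hyp_pol n) (hypB_nondeg n) a haa hqa hL hN
  refine ⟨_, _, (hyp_max_iff n _).2 hL, (hyp_max_iff n _).2 hL2, ?_, ?_⟩
  · rw [sameOrbit_iff n _ _ hL hL2]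
    have h := hpar hL
    have hn' := lag_finrank n hL
    rw [inf_idem, hn'] at h
    omega
  · intro F hF
    have hF' := (hyp_max_iff n F).1 hF
    rw [sameOrbit_iff n _ _ hF' hL, sameOrbit_iff n _ _ hF' hL2]
    have h := hpar hF'
    omega
end

section
/- Let Λ be an even unimodular positive definite lattice of rank m, let E = Λ/2Λ with the quadratic form q(a + 2Λ) = Q(a) mod 2 where Q(x) = (x,x)/2, and let F ⊆ E be a maximal isotropic subspace. Then the preimage π^{-1}(F) of F under the projection π : Λ → E, equipped with the quadratic form Q/2 (i.e. the bilinear form (x,y)/2), is again an even unimodular positive definite lattice of rank m. -/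
open Matrix Module

/-- An even unimodular positive definite lattice of rank `m`, presented by the Gram
matrix of a `ℤ`-basis.  The underlying `ℤ`-module is `Fin m → ℤ`. -/
structure EvenUnimodularLattice (m : ℕ) where
  gram : Matrix (Fin m) (Fin m) ℤ
  symm : gram.IsSymm
  posdef : ∀ x : Fin m → ℤ, x ≠ 0 → 0 < x ⬝ᵥ gram.mulVec x
  even : ∀ x : Fin m → ℤ, 2 ∣ x ⬝ᵥ gram.mulVec x
  unimodular : gram.det = 1

namespace EvenUnimodularLattice

variable {m : ℕ} (Λ : EvenUnimodularLattice m)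

/-- The bilinear form `(x, y)` of the lattice. -/
def inner (Λ : EvenUnimodularLattice m) (x y : Fin m → ℤ) : ℤ := x ⬝ᵥ Λ.gram.mulVec y

/-- Reduction modulo `2Λ`, identifying `Λ/2Λ` with `(F₂)^m` via the chosen basis. -/
def red (_Λ : EvenUnimodularLattice m) (x : Fin m → ℤ) : Fin m → ZMod 2 := fun i => (x i : ZMod 2)

/-- A subspace `F ⊆ Λ/2Λ` is isotropic for the quadratic form
`q(x mod 2Λ) = (x,x)/2 mod 2`, i.e. `(x,x) ≡ 0 (mod 4)` for every lift `x` of an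
element of `F`. -/
def Isotropic (F : Submodule (ZMod 2) (Fin m → ZMod 2)) : Prop :=
  ∀ x : Fin m → ℤ, Λ.red x ∈ F → (4 : ℤ) ∣ Λ.inner x x

/-- A maximal isotropic subspace of `Λ/2Λ`. -/
def MaximalIsotropic (F : Submodule (ZMod 2) (Fin m → ZMod 2)) : Prop :=
  Λ.Isotropic F ∧ ∀ F', Λ.Isotropic F' → F ≤ F' → F' = F

end EvenUnimodularLattice

/-- Splitting off a plane of odd discriminant. -/
lemma split_plane {M : Type} [AddCommGroup M]
    (B : M →ₗ[ℤ] M →ₗ[ℤ] ℤ) (hs : ∀ x y, B x y = B y x)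
    {ι κ : Type} [Fintype ι] [DecidableEq ι] [Fintype κ] [DecidableEq κ]
    (b : Basis ι ℤ M) (N : Submodule ℤ M) (c : Basis κ ℤ N) (e w : M)
    (hN : ∀ x, x ∈ N ↔ B e x = 0 ∧ B w x = 0)
    (hd : Odd (B e e * B w w - B e w * B e w)) :
    Fintype.card κ + 2 = Fintype.card ι ∧ ∃ t : ℤ, Odd t ∧
      (Matrix.of fun i j => B (b i) (b j)).det * t ^ 2 =
        (B e e * B w w - B e w * B e w) *
          (Matrix.of fun i j => B (c i : M) (c j : M)).det := by
  classical
  obtain ⟨δ, hδ⟩ : ∃ δ, δ = B e e * B w w - B e w * B e w := ⟨_, rfl⟩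
  rw [← hδ] at hd ⊢
  have hδ0 : δ ≠ 0 := by rintro rfl; simp at hd
  have hce : ∀ i, B e (c i) = 0 := fun i => ((hN _).1 (c i).2).1
  have hcw : ∀ i, B w (c i) = 0 := fun i => ((hN _).1 (c i).2).2
  let v : Fin 2 ⊕ κ → M := Sum.elim ![e, w] (fun i => (c i : M))
  -- spanning
  have hspan : ∀ x : M, δ • x ∈ Submodule.span ℤ (Set.range v) := by
    intro x
    have he : e ∈ Submodule.span ℤ (Set.range v) := Submodule.subset_span ⟨Sum.inl 0, rfl⟩
    have hw : w ∈ Submodule.span ℤ (Set.range v) := Submodule.subset_span ⟨Sum.inl 1, rfl⟩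
    have hNs : ∀ y ∈ N, y ∈ Submodule.span ℤ (Set.range v) := by
      intro y hy
      have h1 := c.sum_repr ⟨y, hy⟩
      have h2 := congrArg Subtype.val h1
      simp only [Submodule.coe_sum, Submodule.coe_smul] at h2
      rw [← h2]
      exact Submodule.sum_mem _ fun i _ => Submodule.smul_mem _ _
        (Submodule.subset_span ⟨Sum.inr i, rfl⟩)
    have key : δ • x - (B w w * B e x - B e w * B w x) • e
        - (B e e * B w x - B e w * B e x) • w ∈ N := by
      rw [hN]
      simp only [map_sub, map_smul, smul_eq_mul, hδ, hs w e]
      constructor <;> ring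
    have := Submodule.add_mem _ (Submodule.add_mem _ (hNs _ key)
      (Submodule.smul_mem _ (B e e * B w x - B e w * B e x) hw))
      (Submodule.smul_mem _ (B w w * B e x - B e w * B w x) he)
    simpa using this
  -- independence
  have hli : LinearIndependent ℤ v := by
    rw [Fintype.linearIndependent_iff]
    intro g hg
    simp only [Fintype.sum_sum_type, Fin.sum_univ_two, v, Sum.elim_inl, Sum.elim_inr,
      Matrix.cons_val_zero, Matrix.cons_val_one] at hg
    have h1 := congrArg (B e) hg
    have h2 := congrArg (B w) hg
    simp only [map_add, map_sum, map_smul, smul_eq_mul, hce, hcw, mul_zero,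
      Finset.sum_const_zero, map_zero, add_zero, hs w e] at h1 h2
    have h3 : δ * g (Sum.inl 0) = 0 := by
      rw [hδ]; linear_combination B w w * h1 - B e w * h2
    have h4 : δ * g (Sum.inl 1) = 0 := by
      rw [hδ]; linear_combination B e e * h2 - B e w * h1
    have h5 := (mul_eq_zero.1 h3).resolve_left hδ0
    have h6 := (mul_eq_zero.1 h4).resolve_left hδ0
    simp only [h5, h6, zero_smul, zero_add] at hg
    have h7 : ∑ i, g (Sum.inr i) • c i = 0 := by
      apply Subtype.ext
      simpa using hg
    have h8 := Fintype.linearIndependent_iff.1 c.linearIndependent _ h7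
    rintro (i | i)
    · fin_cases i
      · exact h5
      · exact h6
    · exact h8 i
  have : Module.Finite ℤ M := Module.Finite.of_basis b
  have : Module.Free ℤ M := Module.Free.of_basis b
  have hcard : Fintype.card ι = Fintype.card (Fin 2 ⊕ κ) := by
    apply le_antisymm
    · have hb : LinearIndependent ℤ
          (fun i => (⟨δ • b i, hspan _⟩ : Submodule.span ℤ (Set.range v))) := by
        rw [Fintype.linearIndependent_iff]
        intro g hg
        have h1 := congrArg Subtype.val hg
        simp only [Submodule.coe_sum, Submodule.coe_smul, smul_smul, Submodule.coe_zero] at h1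
        intro i
        have := Fintype.linearIndependent_iff.1 b.linearIndependent (fun i => g i * δ) h1 i
        exact (mul_eq_zero.1 this).resolve_right hδ0
      exact hb.fintype_card_le_finrank.trans (finrank_range_le_card v)
    · have := hli.fintype_card_le_finrank
      rwa [Module.finrank_eq_card_basis b] at this
  refine ⟨by rw [hcard]; simp [add_comm], ?_⟩
  let ε : ι ≃ Fin 2 ⊕ κ := Fintype.equivOfCardEq hcard
  let u : ι → M := fun i => v (ε i)
  have hur : Set.range u = Set.range v := by
    ext x; constructor
    · rintro ⟨i, rfl⟩; exact ⟨ε i, rfl⟩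
    · rintro ⟨i, rfl⟩; exact ⟨ε.symm i, by simp [u]⟩
  have hC : ∀ i, ∃ f : ι → ℤ, ∑ j, f j • u j = δ • b i := by
    intro i
    have := hspan (b i)
    rw [← hur] at this
    exact (Submodule.mem_span_range_iff_exists_fun ℤ).1 this
  choose C hC using hC
  let A : Matrix ι ι ℤ := Matrix.of fun i j => b.repr (u i) j
  have hA : ∀ i, u i = ∑ j, A i j • b j := fun i => (b.sum_repr (u i)).symm
  have hCA : Matrix.of C * A = δ • (1 : Matrix ι ι ℤ) := by
    ext i j
    have h := congrArg (fun x => b.repr x j) (hC i)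
    simp only [map_sum, map_smul, Finsupp.coe_finsetSum, Finset.sum_apply, Finsupp.smul_apply,
      smul_eq_mul, Basis.repr_self] at h
    simp only [Matrix.mul_apply, Matrix.of_apply, A, h, Matrix.smul_apply, smul_eq_mul,
      Matrix.one_apply, Finsupp.single_apply]
  have hdetA : Odd A.det := by
    have h := congrArg Matrix.det hCA
    rw [Matrix.det_mul, Matrix.det_smul, Matrix.det_one, mul_one] at h
    have : Odd ((Matrix.of C).det * A.det) := by rw [h]; exact hd.pow
    exact (Int.odd_mul.1 this).2
  refine ⟨A.det, hdetA, ?_⟩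
  have hG : (Matrix.of fun i j => B (u i) (u j)) =
      A * (Matrix.of fun i j => B (b i) (b j)) * Aᵀ := by
    ext i j
    rw [Matrix.of_apply, hA i, hA j]
    simp only [map_sum, map_smul, LinearMap.sum_apply, LinearMap.smul_apply, smul_eq_mul,
      Matrix.mul_apply, Matrix.transpose_apply, Matrix.of_apply, Finset.sum_mul, Finset.mul_sum]
    refine Finset.sum_congr rfl fun x _ => Finset.sum_congr rfl fun y _ => ?_
    ring
  have hG2 : (Matrix.of fun i j => B (u i) (u j)).det =
      δ * (Matrix.of fun i j => B (c i : M) (c j : M)).det := by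
    have h1 : (Matrix.of fun i j => B (u i) (u j)) =
        (Matrix.of fun i j => B (v i) (v j)).submatrix ε ε := rfl
    have h2 : (Matrix.of fun i j => B (v i) (v j)) =
        Matrix.fromBlocks !![B e e, B e w; B e w, B w w] 0 0
          (Matrix.of fun i j => B (c i : M) (c j : M)) := by
      ext i j
      rcases i with i | i <;> rcases j with j | j
      · fin_cases i <;> fin_cases j <;> simp [v, hs w e]
      · fin_cases i <;> simp [v, hce, hcw]
      · fin_cases j <;> simp [v, hs (c i : M) e, hs (c i : M) w, hce, hcw]
      · simp [v]
    rw [h1, Matrix.det_submatrix_equiv_self, h2, Matrix.det_fromBlocks_zero₂₁,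
      Matrix.det_fin_two_of, hδ]
  rw [← hG2, hG, Matrix.det_mul, Matrix.det_mul, Matrix.det_transpose]
  ring

lemma odd_sq_mod8 {t : ℤ} (ht : Odd t) : ∃ s, t ^ 2 = 1 + 8 * s := by
  have := Int.sq_mod_four_eq_one_of_odd ht
  obtain ⟨k, rfl⟩ := ht
  obtain ⟨r, hr⟩ := Int.even_mul_succ_self k
  exact ⟨r, by linear_combination 4 * hr⟩

lemma self_perp : ∀ (n : ℕ) (M : Type) [AddCommGroup M]
    (B : M →ₗ[ℤ] M →ₗ[ℤ] ℤ) (_ : ∀ x y, B x y = B y x) (_ : ∀ x, 2 ∣ B x x)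
    (_ : ∀ x, (∀ y, 2 ∣ B x y) → ∃ z, x = (2 : ℤ) • z)
    (L : Submodule ℤ M) (_ : ∀ x ∈ L, 4 ∣ B x x)
    (_ : ∀ x, (∀ y ∈ L, 2 ∣ B x y) → 4 ∣ B x x → x ∈ L)
    (b : Basis (Fin n) ℤ M)
    (_ : 8 ∣ (Matrix.of fun i j => B (b i) (b j)).det - 1 ∨
      8 ∣ (Matrix.of fun i j => B (b i) (b j)).det + 1),
    ∀ x, (∀ y ∈ L, 2 ∣ B x y) → x ∈ L := by
  intro n
  induction n using Nat.strong_induction_on with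
  | _ n ih =>
  intro M _ B hs hev hnd L h1 h2 b hdet x hx
  have h2L : ∀ z, (2 : ℤ) • z ∈ L := by
    intro z
    apply h2
    · intro y _
      simp
    · simp only [map_smul, LinearMap.smul_apply, smul_eq_mul]
      exact ⟨B z z, by ring⟩
  have : Module.Finite ℤ M := Module.Finite.of_basis b
  have : Module.Free ℤ M := Module.Free.of_basis b
  -- orthogonal complement of a plane
  have orth : ∀ e w : M, ∃ N : Submodule ℤ M, ∀ x, x ∈ N ↔ B e x = 0 ∧ B w x = 0 := by
    intro e w
    exact ⟨LinearMap.ker (B e) ⊓ LinearMap.ker (B w), fun x => by simp⟩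
  have tf : ∀ z : M, ∀ f : M →ₗ[ℤ] ℤ, f ((2 : ℤ) • z) = 0 → f z = 0 := by
    intro z f h
    simpa using h
  have hoddpair : ∀ e w : M, ¬ 2 ∣ B e w → Odd (B e e * B w w - B e w * B e w) := by
    intro e w h
    have ho : Odd (B e w) := by rwa [← Int.not_even_iff_odd, even_iff_two_dvd]
    exact Even.sub_odd ((even_iff_two_dvd.2 (hev e)).mul_right _) (ho.mul ho)
  by_cases hL : ∃ e ∈ L, ∀ z, e ≠ (2 : ℤ) • z
  · obtain ⟨e, heL, he⟩ := hL
    obtain ⟨w, hw⟩ : ∃ w, ¬ 2 ∣ B e w := by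
      by_contra hcon
      push Not at hcon
      obtain ⟨z, hz⟩ := hnd e hcon
      exact he z hz
    obtain ⟨N, hN⟩ := orth e w
    have hδ := hoddpair e w hw
    let c := Module.finBasis ℤ N
    obtain ⟨hk, t, ht, hdt⟩ := split_plane B hs b N c e w hN hδ
    simp only [Fintype.card_fin] at hk
    have ho : Odd (B e w) := by rwa [← Int.not_even_iff_odd, even_iff_two_dvd]
    -- decomposition, mod 2
    have dec : ∀ y : M, ∃ p q : ℤ, ∃ r ∈ N, ∃ z, y = p • e + q • w + r + (2 : ℤ) • z := by
      intro y
      obtain ⟨k, hk⟩ := hδ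
      refine ⟨B w w * B e y - B e w * B w y, B e e * B w y - B e w * B e y,
        (B e e * B w w - B e w * B e w) • y - (B w w * B e y - B e w * B w y) • e
        - (B e e * B w y - B e w * B e y) • w, ?_, -(k • y), ?_⟩
      · rw [hN]
        simp only [map_sub, map_smul, smul_eq_mul, hs w e]
        constructor <;> ring
      · rw [hk]; module
    have decL : ∀ y : M, 2 ∣ B e y → ∃ p : ℤ, ∃ r ∈ N, ∃ z, y = p • e + r + (2 : ℤ) • z := by
      intro y hy
      obtain ⟨p, q, r, hr, z, rfl⟩ := dec y
      simp only [map_add, map_smul, smul_eq_mul, ((hN r).1 hr).1, add_zero] at hy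
      have hq : 2 ∣ q := by
        have h3 : 2 ∣ q * B e w := by
          have h4 := hev e
          have : 2 ∣ (p * B e e + q * B e w + 2 * B e z) - p * B e e - 2 * B e z :=
            dvd_sub (dvd_sub hy (Dvd.dvd.mul_left h4 _)) (Dvd.intro _ rfl)
          ring_nf at this ⊢
          exact this
        exact (Int.prime_two.dvd_mul.1 h3).resolve_right hw
      obtain ⟨q', rfl⟩ := hq
      exact ⟨p, r, hr, z + q' • w, by module⟩
    have hLe : ∀ y ∈ L, 2 ∣ B e y := by
      intro y hy
      have a1 := h1 _ (L.add_mem heL hy)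
      have a2 := h1 _ heL
      have a3 := h1 _ hy
      simp only [map_add, LinearMap.add_apply, hs y e] at a1
      omega
    -- apply the induction hypothesis
    let B' : N →ₗ[ℤ] N →ₗ[ℤ] ℤ := B.domRestrict₁₂ N N
    have hB' : ∀ x y : N, B' x y = B x y := fun x y => rfl
    have IH := ih (Module.finrank ℤ N) (by omega) N B' (fun x y => hs _ _) (fun x => hev _) ?_
      (L.comap N.subtype) (fun x hx => h1 _ hx) ?_ c ?_
    · obtain ⟨p, r, hr, z, rfl⟩ := decL x (by rw [hs]; exact hx e heL)
      refine L.add_mem (L.add_mem (L.smul_mem _ heL) ?_) (h2L z)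
      refine IH ⟨r, hr⟩ ?_
      intro y hy
      have := hx y hy
      have h3 := hLe y hy
      simp only [map_add, map_smul, LinearMap.add_apply, LinearMap.smul_apply, smul_eq_mul] at this
      rw [hB']
      change 2 ∣ B r y
      have h5 : 2 ∣ (p * B e y + B r y + 2 * B z y) - p * B e y - 2 * B z y :=
        dvd_sub (dvd_sub this (Dvd.dvd.mul_left h3 _)) (Dvd.intro _ rfl)
      ring_nf at h5 ⊢
      exact h5
    · intro x hx
      obtain ⟨z, hz⟩ := hnd x (by
        intro y
        obtain ⟨p, q, r, hr, z, rfl⟩ := dec y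
        have := hx ⟨r, hr⟩
        rw [hB'] at this
        simp only [map_add, map_smul, smul_eq_mul, hs x.1 e, hs x.1 w, ((hN _).1 x.2).1,
          ((hN _).1 x.2).2]
        simpa using this)
      have hx2 := (hN _).1 x.2
      rw [hz] at hx2
      exact ⟨⟨z, (hN _).2 ⟨tf z _ hx2.1, tf z _ hx2.2⟩⟩, Subtype.ext hz⟩
    · intro x hx hx4
      refine h2 _ ?_ hx4
      intro y hy
      obtain ⟨p, r, hr, z, hyz⟩ := decL y (hLe y hy)
      have hrL : r ∈ L := by
        have : r = y - p • e - (2 : ℤ) • z := by rw [hyz]; module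
        rw [this]
        exact L.sub_mem (L.sub_mem hy (L.smul_mem _ heL)) (h2L z)
      have := hx ⟨r, hr⟩ hrL
      rw [hB'] at this
      change 2 ∣ B x.1 y
      rw [hyz]
      simp only [map_add, map_smul, smul_eq_mul, hs x.1 e, ((hN _).1 x.2).1]
      simpa using this
    · obtain ⟨s, hs1⟩ := odd_sq_mod8 ht
      obtain ⟨s', hs2⟩ := odd_sq_mod8 ho
      obtain ⟨a, ha⟩ := h1 e heL
      obtain ⟨d, hd⟩ := hev w
      change 8 ∣ (Matrix.of fun i j => B (c i : M) (c j : M)).det - 1 ∨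
        8 ∣ (Matrix.of fun i j => B (c i : M) (c j : M)).det + 1
      have h3 : B e e * B w w - B e w * B e w = -1 + 8 * (a * d - s') := by
        rw [ha, hd]; linear_combination -hs2
      rw [h3, hs1] at hdt
      generalize (Matrix.of fun i j => B (c i : M) (c j : M)).det = g' at hdt ⊢
      generalize (Matrix.of fun i j => B (b i : M) (b j : M)).det = g at hdt hdet
      have h4 : 8 ∣ g + g' := ⟨(a * d - s') * g' - g * s, by linear_combination hdt⟩
      omega
  · push Not at hL
    by_contra hxL
    have hx2 : ∀ z, x ≠ (2 : ℤ) • z := by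
      rintro z rfl; exact hxL (h2L z)
    have hani : ∀ y, 4 ∣ B y y → ∃ z, y = (2 : ℤ) • z := by
      intro y hy
      apply hL
      refine h2 y ?_ hy
      intro u hu
      obtain ⟨z, rfl⟩ := hL u hu
      simp
    obtain ⟨w, hw⟩ : ∃ w, ¬ 2 ∣ B x w := by
      by_contra hcon
      push Not at hcon
      obtain ⟨z, hz⟩ := hnd x hcon
      exact hx2 z hz
    have hxx : ¬ 4 ∣ B x x := fun h => by
      obtain ⟨z, hz⟩ := hani x h
      exact hx2 z hz
    have hww : ¬ 4 ∣ B w w := fun h => by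
      obtain ⟨z, rfl⟩ := hani w h
      simp at hw
    obtain ⟨N, hN⟩ := orth x w
    have hδ := hoddpair x w hw
    let c := Module.finBasis ℤ N
    obtain ⟨hk, t, ht, hdt⟩ := split_plane B hs b N c x w hN hδ
    have hN2 : ∀ z ∈ N, ∃ u, z = (2 : ℤ) • u := by
      intro z hz
      apply hani
      by_contra hzz
      have hz' := (hN z).1 hz
      have h3 : 4 ∣ B (z + x) (z + x) := by
        have h4 := hev z
        have h5 := hev x
        simp only [map_add, LinearMap.add_apply, hs z x, hz'.1]
        omega
      obtain ⟨u, hu⟩ := hani _ h3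
      have h4 : B w (z + x) = B w ((2 : ℤ) • u) := by rw [hu]
      simp only [map_add, map_smul, smul_eq_mul, hz'.2, hs w x] at h4
      omega
    have hempty : IsEmpty (Fin (Module.finrank ℤ N)) := by
      constructor
      intro i
      obtain ⟨u, hu⟩ := hN2 _ (c i).2
      have hi := (hN _).1 (c i).2
      rw [hu] at hi
      have huN : u ∈ N := (hN _).2 ⟨tf u _ hi.1, tf u _ hi.2⟩
      have h3 : c i = (2 : ℤ) • (⟨u, huN⟩ : N) := Subtype.ext hu
      have h4 := congrArg (fun y => c.repr y i) h3
      simp only [Basis.repr_self, map_smul, Finsupp.smul_apply, smul_eq_mul,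
        Finsupp.single_eq_same] at h4
      omega
    have ho : Odd (B x w) := by rwa [← Int.not_even_iff_odd, even_iff_two_dvd]
    rw [Matrix.det_isEmpty (A := Matrix.of fun i j => B (c i : M) (c j : M)), mul_one] at hdt
    obtain ⟨s, hs1⟩ := odd_sq_mod8 ht
    obtain ⟨s', hs2⟩ := odd_sq_mod8 ho
    have hx' : ∃ a, B x x = 2 + 4 * a := ⟨(B x x - 2) / 4, by have := hev x; omega⟩
    have hw' : ∃ a, B w w = 2 + 4 * a := ⟨(B w w - 2) / 4, by have := hev w; omega⟩
    obtain ⟨a, ha⟩ := hx'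
    obtain ⟨d, hd⟩ := hw'
    have h3 : B x x * B w w - B x w * B x w = 3 + 8 * (a + d + 2 * a * d - s') := by
      rw [ha, hd]; linear_combination -hs2
    rw [h3, hs1] at hdt
    generalize (Matrix.of fun i j => B (b i : M) (b j : M)).det = g at hdt hdet
    have h4 : 8 ∣ g - 3 := ⟨(a + d + 2 * a * d - s') - g * s, by linear_combination hdt⟩
    omega

/-- **perestroika.** Let `Λ` be an even unimodular positive definite
lattice of rank `m`, `E = Λ/2Λ` with `q(a+2Λ) = (a,a)/2 mod 2`, and `F ⊆ E` maximal
isotropic.  Then the preimage `π⁻¹(F)` of `F` in `Λ`, with the bilinear form halved,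
is again an even unimodular positive definite lattice of rank `m`: it has a `ℤ`-basis
`g` whose halved Gram matrix is the Gram matrix of an even unimodular positive
definite lattice. -/
theorem perestroika_even_unimodular {m : ℕ} (Λ : EvenUnimodularLattice m)
    (F : Submodule (ZMod 2) (Fin m → ZMod 2)) (hF : Λ.MaximalIsotropic F) :
    ∃ (g : Fin m → (Fin m → ℤ)) (P : EvenUnimodularLattice m),
      (∀ v : Fin m → ℤ, Λ.red v ∈ F ↔ v ∈ Submodule.span ℤ (Set.range g)) ∧
      (∀ i j, 2 * P.gram i j = Λ.inner (g i) (g j)) := by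
  classical
  let B : (Fin m → ℤ) →ₗ[ℤ] (Fin m → ℤ) →ₗ[ℤ] ℤ := Matrix.toLinearMap₂' ℤ Λ.gram
  have hB : ∀ x y, B x y = Λ.inner x y := by
    intro x y
    simp only [B, Matrix.toLinearMap₂'_apply', EvenUnimodularLattice.inner]
  have hs : ∀ x y, B x y = B y x := by
    intro x y
    rw [hB, hB, EvenUnimodularLattice.inner, EvenUnimodularLattice.inner, dotProduct_comm,
      ← Matrix.vecMul_transpose, Λ.symm.eq, ← Matrix.dotProduct_mulVec]
  let L : Submodule ℤ (Fin m → ℤ) :=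
    { carrier := {x | Λ.red x ∈ F}
      add_mem' := by
        intro x y hx hy
        have : Λ.red (x + y) = Λ.red x + Λ.red y := by
          ext i; simp [EvenUnimodularLattice.red]
        simp only [Set.mem_ofPred_eq] at *
        rw [this]; exact F.add_mem hx hy
      zero_mem' := by
        have : Λ.red 0 = 0 := by
          ext i; simp [EvenUnimodularLattice.red]
        simp only [Set.mem_ofPred_eq, this]; exact F.zero_mem
      smul_mem' := by
        intro k x hx
        have : Λ.red (k • x) = (k : ZMod 2) • Λ.red x := by
          ext i; simp [EvenUnimodularLattice.red]
        simp only [Set.mem_ofPred_eq] at *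
        rw [this]; exact F.smul_mem _ hx }
  have hLF : ∀ x, x ∈ L ↔ Λ.red x ∈ F := fun x => Iff.rfl
  have h1 : ∀ x ∈ L, 4 ∣ B x x := fun x hx => by rw [hB]; exact hF.1 x hx
  have h2 : ∀ x, (∀ y ∈ L, 2 ∣ B x y) → 4 ∣ B x x → x ∈ L := by
    intro x hx hxx
    have hiso : Λ.Isotropic (F ⊔ Submodule.span (ZMod 2) {Λ.red x}) := by
      intro z hz
      rw [← hB]
      obtain ⟨f, hf, g, hg, hfg⟩ := Submodule.mem_sup.1 hz
      obtain ⟨k, rfl⟩ := Submodule.mem_span_singleton.1 hg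
      have hk : k = 0 ∨ k = 1 := (by decide : ∀ k : ZMod 2, k = 0 ∨ k = 1) k
      rcases hk with rfl | rfl
      · apply h1
        rw [hLF, ← hfg]; simpa using hf
      · have hzx : z - x ∈ L := by
          rw [hLF]
          have : Λ.red (z - x) = f := by
            have h3 : Λ.red (z - x) = Λ.red z - Λ.red x := by
              ext i; simp [EvenUnimodularLattice.red]
            rw [h3, ← hfg]; simp
          rw [this]; exact hf
        have h3 := h1 _ hzx
        have h4 := hx _ hzx
        simp only [map_sub, LinearMap.sub_apply, hs z x] at h3 h4
        omega
    have := hF.2 _ hiso le_sup_left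
    rw [hLF, ← this]
    exact Submodule.mem_sup_right (Submodule.mem_span_singleton_self _)
  have hdetu : IsUnit Λ.gram.det := by rw [Λ.unimodular]; exact isUnit_one
  have hnd : ∀ x, (∀ y, 2 ∣ B x y) → ∃ z, x = (2 : ℤ) • z := by
    intro x hx
    have h3 : ∀ i, ∃ k, (Λ.gram *ᵥ x) i = 2 * k := by
      intro i
      have := hx (Pi.single i 1)
      rw [hs, hB, EvenUnimodularLattice.inner, single_one_dotProduct] at this
      exact this
    choose k hk using h3
    refine ⟨Λ.gram⁻¹ *ᵥ k, ?_⟩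
    rw [← Matrix.mulVec_smul]
    have : (2 : ℤ) • k = Λ.gram *ᵥ x := by ext i; simp [hk]
    rw [this, Matrix.mulVec_mulVec, Matrix.nonsing_inv_mul _ hdetu, Matrix.one_mulVec]
  have hself : ∀ x, (∀ y ∈ L, 2 ∣ B x y) → x ∈ L := by
    refine self_perp m _ B hs (fun x => by rw [hB]; exact Λ.even x) hnd L h1 h2
      (Pi.basisFun ℤ (Fin m)) (Or.inl ?_)
    have : (Matrix.of fun i j => B (Pi.basisFun ℤ (Fin m) i) (Pi.basisFun ℤ (Fin m) j))
        = Λ.gram := by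
      ext i j
      simp [hB, EvenUnimodularLattice.inner]
    rw [this, Λ.unimodular]; simp
  have h2L : ∀ z, (2 : ℤ) • z ∈ L := by
    intro z
    apply hself
    intro y _
    rw [map_smul, LinearMap.smul_apply]
    exact Dvd.intro _ rfl
  have hLL : ∀ x ∈ L, ∀ y ∈ L, 2 ∣ B x y := by
    intro x hx y hy
    have a1 := h1 _ (L.add_mem hx hy)
    have a2 := h1 _ hx
    have a3 := h1 _ hy
    simp only [map_add, LinearMap.add_apply, hs y x] at a1
    omega
  -- a basis of `L`
  have hrank : Module.finrank ℤ L = m := by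
    apply le_antisymm
    · have := Submodule.finrank_le L
      simpa using this
    · have hb : LinearIndependent ℤ
          (fun i => (⟨(2 : ℤ) • Pi.basisFun ℤ (Fin m) i, h2L _⟩ : L)) := by
        rw [Fintype.linearIndependent_iff]
        intro g hg
        have h3 := congrArg Subtype.val hg
        simp only [Submodule.coe_sum, Submodule.coe_smul, smul_smul, Submodule.coe_zero] at h3
        intro i
        have := Fintype.linearIndependent_iff.1 (Pi.basisFun ℤ (Fin m)).linearIndependent
          (fun i => g i * 2) h3 i
        simpa using this
      simpa using hb.fintype_card_le_finrank
  let c : Basis (Fin m) ℤ L := Module.finBasisOfFinrankEq ℤ L hrank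
  let A : Matrix (Fin m) (Fin m) ℤ := Matrix.of fun i => (c i : Fin m → ℤ)
  have hcL : ∀ i, (c i : Fin m → ℤ) ∈ L := fun i => (c i).2
  have hrep : ∀ y ∈ L, ∃ k : Fin m → ℤ, y = k ᵥ* A := by
    intro y hy
    refine ⟨c.repr ⟨y, hy⟩, ?_⟩
    have h3 := congrArg Subtype.val (c.sum_repr ⟨y, hy⟩)
    simp only [Submodule.coe_sum, Submodule.coe_smul] at h3
    rw [Matrix.vecMul_eq_sum]
    exact h3.symm
  have hAL : ∀ k : Fin m → ℤ, k ᵥ* A ∈ L := by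
    intro k
    rw [Matrix.vecMul_eq_sum]
    exact L.sum_mem fun i _ => L.smul_mem _ (hcL i)
  choose Pm hPm using fun i j => hLL _ (hcL i) _ (hcL j)
  have hAGA : A * Λ.gram * Aᵀ = (2 : ℤ) • Matrix.of Pm := by
    ext i j
    rw [Matrix.smul_apply, Matrix.of_apply, smul_eq_mul, ← hPm, hB, Matrix.mul_assoc]
    simp only [EvenUnimodularLattice.inner, Matrix.mul_apply, dotProduct, Matrix.mulVec,
      Matrix.transpose_apply, A, Matrix.of_apply]
  have hform : ∀ x, 2 * (x ⬝ᵥ (Matrix.of Pm) *ᵥ x) = B (x ᵥ* A) (x ᵥ* A) := by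
    intro x
    rw [hB, EvenUnimodularLattice.inner, ← smul_eq_mul, ← dotProduct_smul,
      ← Matrix.smul_mulVec, ← hAGA, Matrix.mul_assoc, ← Matrix.mulVec_mulVec,
      ← Matrix.mulVec_mulVec, Matrix.mulVec_transpose, Matrix.dotProduct_mulVec]
  -- `A` is invertible up to a factor 2
  choose C hC using fun i => hrep _ (h2L (Pi.single i 1))
  have hCA : Matrix.of C * A = (2 : ℤ) • (1 : Matrix (Fin m) (Fin m) ℤ) := by
    ext i j
    have := congrFun (hC i) j
    rw [Matrix.mul_apply]
    simp only [Matrix.vecMul, dotProduct] at this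
    simp only [Matrix.of_apply]
    rw [← this]
    simp [Matrix.one_apply, Pi.single_apply, eq_comm]
  have hdA : A.det ≠ 0 := by
    intro h
    have h3 := congrArg Matrix.det hCA
    rw [Matrix.det_mul, h, mul_zero, Matrix.det_smul, Matrix.det_one, mul_one] at h3
    exact absurd h3.symm (by positivity)
  have hAC : A * Matrix.of C = (2 : ℤ) • (1 : Matrix (Fin m) (Fin m) ℤ) := by
    have h3 : A * (A.adjugate * (A * Matrix.of C)) = 0 + A.det • (A * Matrix.of C) := by
      rw [← Matrix.mul_assoc, Matrix.mul_adjugate, Matrix.smul_mul, Matrix.one_mul, zero_add]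
    have h4 : A.det • (A * Matrix.of C) = A.det • ((2 : ℤ) • (1 : Matrix (Fin m) (Fin m) ℤ)) := by
      calc A.det • (A * Matrix.of C) = (A * Matrix.of C) * (A * A.adjugate) := by
            rw [Matrix.mul_adjugate, Matrix.mul_smul, Matrix.mul_one]
        _ = A * (Matrix.of C * A) * A.adjugate := by simp only [Matrix.mul_assoc]
        _ = _ := by
            rw [hCA, Matrix.mul_smul, Matrix.mul_one, Matrix.smul_mul, Matrix.mul_adjugate,
              smul_comm]
    exact smul_right_injective _ hdA h4
  have hY : ∀ j, ∃ k : Fin m → ℤ, (Λ.gram⁻¹ * Matrix.of C)ᵀ j = k ᵥ* A := by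
    intro j
    apply hrep
    apply hself
    intro y hy
    obtain ⟨k, rfl⟩ := hrep y hy
    have h3 : (Λ.gram⁻¹ * Matrix.of C)ᵀ j = (Λ.gram⁻¹ * Matrix.of C) *ᵥ Pi.single j 1 := by
      rw [Matrix.mulVec_single_one]; rfl
    rw [hs, hB, EvenUnimodularLattice.inner, h3, Matrix.mulVec_mulVec, ← Matrix.mul_assoc,
      Matrix.mul_nonsing_inv _ hdetu, Matrix.one_mul, ← Matrix.dotProduct_mulVec,
      Matrix.mulVec_mulVec, hAC, Matrix.smul_mulVec, dotProduct_smul]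
    exact Dvd.intro _ rfl
  choose Z hZ using hY
  have hZA : Λ.gram⁻¹ * Matrix.of C = Aᵀ * (Matrix.of Z)ᵀ := by
    rw [← Matrix.transpose_mul]
    ext i j
    exact congrFun (hZ j) i
  have hPZ : Matrix.of Pm * (Matrix.of Z)ᵀ = 1 := by
    have h3 : (2 : ℤ) • (Matrix.of Pm * (Matrix.of Z)ᵀ) =
        (2 : ℤ) • (1 : Matrix (Fin m) (Fin m) ℤ) := by
      rw [← Matrix.smul_mul, ← hAGA, Matrix.mul_assoc, ← hZA, Matrix.mul_assoc,
        ← Matrix.mul_assoc Λ.gram, Matrix.mul_nonsing_inv _ hdetu, Matrix.one_mul, hAC]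
    exact smul_right_injective _ (two_ne_zero) h3
  have hdetP : (Matrix.of Pm).det = 1 := by
    have h3 := congrArg Matrix.det hPZ
    rw [Matrix.det_mul, Matrix.det_one] at h3
    have h4 := congrArg Matrix.det hAGA
    rw [Matrix.det_mul, Matrix.det_mul, Λ.unimodular, Matrix.det_transpose, Matrix.det_smul,
      mul_one] at h4
    have h5 : 0 ≤ (Matrix.of Pm).det := by
      have h6 : 0 ≤ A.det * A.det := mul_self_nonneg _
      rw [h4] at h6
      exact nonneg_of_mul_nonneg_right h6 (by positivity)
    rcases Int.isUnit_iff.1 (IsUnit.of_mul_eq_one _ h3) with h | h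
    · exact h
    · omega
  refine ⟨fun i => (c i : Fin m → ℤ), ⟨Matrix.of Pm, ?_, ?_, ?_, hdetP⟩, ?_, ?_⟩
  · ext i j
    have h3 := hPm i j
    have h4 := hPm j i
    rw [hs] at h4
    simp only [Matrix.transpose_apply, Matrix.of_apply]
    omega
  · intro x hx
    have h3 := hform x
    have h4 : x ᵥ* A ≠ 0 := by
      intro h
      exact hx (Matrix.eq_zero_of_vecMul_eq_zero hdA h)
    have h5 := Λ.posdef _ h4
    rw [hB, EvenUnimodularLattice.inner] at h3
    omega
  · intro x
    have h3 := hform x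
    have h4 := h1 _ (hAL x)
    omega
  · intro v
    rw [← hLF]
    constructor
    · intro hv
      obtain ⟨k, rfl⟩ := hrep v hv
      rw [Matrix.vecMul_eq_sum]
      exact Submodule.sum_mem _ fun i _ => Submodule.smul_mem _ _ (Submodule.subset_span ⟨i, rfl⟩)
    · intro hv
      refine (Submodule.span_le.2 ?_) hv
      rintro _ ⟨i, rfl⟩
      exact hcL i
  · intro i j
    rw [← hB, hPm]
    rfl
end

section
/- Let Λ be an even unimodular positive definite lattice and E = Λ/2Λ with the induced quadratic form. Every automorphism of Λ induces an orthogonal transformation of (E, q), and the composition of the natural homomorphism Aut(Λ) → O(E) with (−1)^D, where D is the Dickson invariant, equals the determinant character on Aut(Λ). In particular, if every automorphism of Λ has determinant +1, then the image of Aut(Λ) in O(E) lies in the kernel of the Dickson invariant. -/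
open Matrix Module

section Helpers
variable {R : Type*} [CommRing R]

lemma det_triangular_core [IsDomain R] [CharZero R] {n₁ n₂ : Type*} [Fintype n₁] [DecidableEq n₁] [Fintype n₂] [DecidableEq n₂]
    (M₁ : Matrix n₁ n₁ R) (M₃ : Matrix n₂ n₁ R) (M₄ : Matrix n₂ n₂ R) (h₁ : IsUnit M₁.det)
    (K : Matrix (n₁ ⊕ n₂) (n₁ ⊕ n₂) R)
    (hrel : fromBlocks M₁ 0 ((2:R) • M₃) ((2:R) • M₄) + (fromBlocks M₁ 0 ((2:R) • M₃) ((2:R) • M₄))ᵀ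
      + (fromBlocks M₁ 0 ((2:R) • M₃) ((2:R) • M₄))ᵀ * (K + Kᵀ) * (fromBlocks M₁ 0 ((2:R) • M₃) ((2:R) • M₄)) = 0) :
    ∃ t : R, (1 + (K + Kᵀ) * fromBlocks M₁ 0 ((2:R) • M₃) ((2:R) • M₄)).det
      = (-1) ^ Fintype.card n₁ * (1 + 4 * t) := by
  have h2 : (2:R) ≠ 0 := two_ne_zero
  obtain ⟨K₁, K₂, K₃, K₄, rfl⟩ : ∃ K₁ K₂ K₃ K₄, K = fromBlocks K₁ K₂ K₃ K₄ :=
    ⟨_, _, _, _, (fromBlocks_toBlocks K).symm⟩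
  simp only [fromBlocks_transpose, fromBlocks_add, fromBlocks_multiply, ← fromBlocks_one,
    ← fromBlocks_zero] at hrel ⊢
  rw [fromBlocks_inj] at hrel
  obtain ⟨e1, e2, e3, e4⟩ := hrel
  set H₁ := K₁ + K₁ᵀ
  set H₂ := K₂ + K₃ᵀ
  set H₃ := K₃ + K₂ᵀ
  set H₄ := K₄ + K₄ᵀ with hH₄
  simp only [Matrix.mul_zero, zero_add, add_zero, transpose_smul, transpose_zero, Matrix.zero_mul] at *
  set a := 1 + (H₁ * M₁ + H₂ * (2:R) • M₃) with ha
  set c := H₃ * M₁ + H₄ * (2:R) • M₃ with hc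
  -- triangular identity
  have key : fromBlocks M₁ᵀ ((2:R) • M₃ᵀ) 0 1 *
      fromBlocks a (H₂ * (2:R) • M₄) c (1 + H₄ * (2:R) • M₄)
      = fromBlocks (-M₁) 0 c (1 + H₄ * (2:R) • M₄) := by
    rw [fromBlocks_multiply, fromBlocks_inj]
    refine ⟨?_, ?_, by simp, by simp⟩
    · rw [eq_neg_iff_add_eq_zero, ← e1, ha, hc]
      simp only [Matrix.mul_add, Matrix.add_mul, Matrix.mul_one, Matrix.mul_assoc]; abel
    · rw [← e2]
      simp only [Matrix.mul_add, Matrix.add_mul, Matrix.mul_one, Matrix.mul_assoc]; abel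
  have hd := congrArg det key
  rw [det_mul, det_fromBlocks_zero₂₁, det_fromBlocks_zero₁₂, det_one, mul_one, det_transpose,
    det_neg] at hd
  have hdet : (fromBlocks a (H₂ * (2:R) • M₄) c (1 + H₄ * (2:R) • M₄)).det
      = (-1) ^ Fintype.card n₁ * (1 + H₄ * (2:R) • M₄).det := by
    apply h₁.mul_left_cancel
    rw [hd]; ring
  rw [hdet]
  have e5 : M₄ + M₄ᵀ = -((2:R) • (M₄ᵀ * H₄ * M₄)) := by
    rw [eq_neg_iff_add_eq_zero]
    apply smul_right_injective _ h2
    simp only [smul_zero]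
    rw [← e4]
    simp only [Matrix.smul_mul, Matrix.mul_smul, smul_add]
  have tr : trace (H₄ * M₄) = 2 * -(trace (K₄ * (M₄ᵀ * H₄ * M₄))) := by
    have : trace (H₄ * M₄) = trace (K₄ * (M₄ + M₄ᵀ)) := by
      rw [hH₄, add_mul, mul_add, trace_add, trace_add, ← trace_transpose (K₄ᵀ * M₄),
        transpose_mul, transpose_transpose, trace_mul_comm M₄ᵀ]
    rw [this, e5]; simp
  have hm : H₄ * (2:R) • M₄ = (2:R) • (H₄ * M₄) := by simp
  rw [hm, det_one_add_smul, tr]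
  generalize Polynomial.eval (2:R) _ = p
  generalize trace (K₄ * (M₄ᵀ * H₄ * M₄)) = q
  exact ⟨-q + p, by ring⟩

/-- congruence invariance -/
lemma wall_rel_congr {n k : Type*} [Fintype n] [DecidableEq n] [Fintype k] [DecidableEq k]
    (M K : Matrix n n R) (P : Matrix n k R) (P' : Matrix k n R) (h : P * P' = 1)
    (hrel : M + Mᵀ + Mᵀ * (K + Kᵀ) * M = 0) :
    (Pᵀ * M * P) + (Pᵀ * M * P)ᵀ + (Pᵀ * M * P)ᵀ * ((P' * K * P'ᵀ) + (P' * K * P'ᵀ)ᵀ) * (Pᵀ * M * P) = 0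
    ∧ (1 + ((P' * K * P'ᵀ) + (P' * K * P'ᵀ)ᵀ) * (Pᵀ * M * P)).det = (1 + (K + Kᵀ) * M).det := by
  have ht : P'ᵀ * Pᵀ = 1 := by rw [← transpose_mul, h, transpose_one]
  have e : (P' * K * P'ᵀ) + (P' * K * P'ᵀ)ᵀ = P' * (K + Kᵀ) * P'ᵀ := by
    simp only [transpose_mul, transpose_transpose, Matrix.mul_add, Matrix.add_mul, Matrix.mul_assoc]
  have e' : P' * (K + Kᵀ) * P'ᵀ * (Pᵀ * M * P) = P' * ((K + Kᵀ) * M * P) := by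
    calc _ = P' * (K + Kᵀ) * (P'ᵀ * Pᵀ) * M * P := by simp only [Matrix.mul_assoc]
      _ = _ := by rw [ht]; simp only [Matrix.mul_assoc, Matrix.one_mul]
  rw [e]
  constructor
  · rw [Matrix.mul_assoc _ _ (Pᵀ * M * P), e']
    have : (Pᵀ * M * P)ᵀ * (P' * ((K + Kᵀ) * M * P)) = Pᵀ * (Mᵀ * (K + Kᵀ) * M) * P := by
      calc _ = Pᵀ * Mᵀ * (P * P') * ((K + Kᵀ) * M * P) := by
            simp only [transpose_mul, transpose_transpose, Matrix.mul_assoc]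
        _ = _ := by rw [h]; simp only [Matrix.mul_assoc, Matrix.mul_one]
    rw [this]
    have e2 : (Pᵀ * M * P)ᵀ = Pᵀ * Mᵀ * P := by
      simp only [transpose_mul, transpose_transpose, Matrix.mul_assoc]
    rw [e2, ← Matrix.add_mul, ← Matrix.mul_add, ← Matrix.add_mul, ← Matrix.mul_add, hrel]
    simp
  · rw [e', det_one_add_mul_comm, Matrix.mul_assoc, h, Matrix.mul_one]

lemma det_block_core [IsDomain R] [CharZero R] {n₁ n₂ : Type*} [Fintype n₁] [DecidableEq n₁] [Fintype n₂] [DecidableEq n₂]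
    (M₁ : Matrix n₁ n₁ R) (M₂ : Matrix n₁ n₂ R) (M₃ : Matrix n₂ n₁ R) (M₄ : Matrix n₂ n₂ R)
    (h₁ : IsUnit M₁.det)
    (K M : Matrix (n₁ ⊕ n₂) (n₁ ⊕ n₂) R)
    (hM : M = fromBlocks M₁ ((2:R) • M₂) ((2:R) • M₃) ((2:R) • M₄))
    (hrel : M + Mᵀ + Mᵀ * (K + Kᵀ) * M = 0) :
    ∃ t : R, (1 + (K + Kᵀ) * M).det = (-1) ^ Fintype.card n₁ * (1 + 4 * t) := by
  let Y : Matrix n₁ n₂ R := - (M₁⁻¹ * M₂)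
  let P : Matrix (n₁ ⊕ n₂) (n₁ ⊕ n₂) R := fromBlocks 1 ((2:R) • Y) 0 1
  let P' : Matrix (n₁ ⊕ n₂) (n₁ ⊕ n₂) R := fromBlocks 1 (-((2:R) • Y)) 0 1
  have hP : P * P' = 1 := by
    simp [P, P', fromBlocks_multiply]
  obtain ⟨h, h'⟩ := wall_rel_congr M K P P' hP hrel
  have hY : M₁ * Y = - M₂ := by
    simp [Y, Matrix.mul_nonsing_inv_cancel_left _ _ h₁]
  have hform : Pᵀ * M * P = fromBlocks M₁ 0 ((2:R) • (Yᵀ * M₁ + M₃))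
      ((2:R) • (M₄ + (2:R) • (Yᵀ * M₂) + (2 : R) • ((Yᵀ * M₁ + M₃) * Y))) := by
    rw [hM]
    simp only [P, fromBlocks_transpose, fromBlocks_multiply]
    rw [fromBlocks_inj]
    refine ⟨by simp, by simp [hY], by simp, ?_⟩
    simp only [transpose_smul, transpose_one, Matrix.smul_mul, Matrix.mul_smul, Matrix.mul_one,
      Matrix.one_mul, smul_add, Matrix.add_mul]
    abel
  rw [hform] at h h'
  rw [← h']
  exact det_triangular_core _ _ _ h₁ _ h

lemma exists_adapted {F : Type*} [Field F] {n : Type*} [Fintype n] [DecidableEq n]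
    (A : Matrix n n F) : ∃ (s : ℕ) (P : Matrix n (Fin A.rank ⊕ Fin s) F)
      (P' : Matrix (Fin A.rank ⊕ Fin s) n F), P * P' = 1 ∧ P' * P = 1 ∧
      ∀ i j, (A * P) i (Sum.inr j) = 0 := by
  obtain ⟨V, W, e, hV, hW, h⟩ := exists_rank_normal_form A
  have hWd := (isUnit_iff_isUnit_det _).1 hW
  have hVd := (isUnit_iff_isUnit_det _).1 hV
  refine ⟨_, W.submatrix id e.symm, W⁻¹.submatrix e.symm id, ?_, ?_, ?_⟩
  · rw [submatrix_mul_equiv, mul_nonsing_inv _ hWd, submatrix_id_id]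
  · rw [← submatrix_mul _ _ e.symm id e.symm Function.bijective_id, nonsing_inv_mul _ hWd,
      submatrix_one_equiv]
  · intro i j
    have : A * W = V⁻¹ * (fromBlocks 1 0 0 0).submatrix e e := by
      rw [← h, Matrix.mul_assoc, nonsing_inv_mul_cancel_left _ _ hVd]
    have h2 : A * W.submatrix id e.symm = (A * W).submatrix id e.symm := by
      rw [submatrix_mul _ _ id id e.symm Function.bijective_id, submatrix_id_id]
    rw [h2, this, submatrix_apply, mul_apply]
    apply Finset.sum_eq_zero
    intro x _
    rw [submatrix_apply, Equiv.apply_symm_apply]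
    rcases e x with y | y <;> simp

lemma isUnit_det_of_rank {F : Type*} [Field F] {n : Type*} [Fintype n] [DecidableEq n]
    (A : Matrix n n F) (h : Fintype.card n ≤ A.rank) : IsUnit A.det := by
  have hr : A.rank = Fintype.card n := le_antisymm A.rank_le_card_width h
  rw [← isUnit_iff_isUnit_det, ← mulVec_surjective_iff_isUnit]
  have : LinearMap.range A.mulVecLin = ⊤ := by
    apply Submodule.eq_top_of_finrank_eq
    rw [Module.finrank_fintype_fun_eq_card, ← hr]; rfl
  exact LinearMap.range_eq_top.1 this

lemma padic_two_dvd (x : ℤ_[2]) (h : PadicInt.toZMod x = 0) : ∃ y, x = 2 * y := by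
  have : x ∈ RingHom.ker (PadicInt.toZMod : ℤ_[2] →+* ZMod 2) := h
  rw [PadicInt.ker_toZMod, PadicInt.maximalIdeal_eq_span_p, Ideal.mem_span_singleton] at this
  exact_mod_cast this

lemma padic_isUnit (x : ℤ_[2]) (h : PadicInt.toZMod x ≠ 0) : IsUnit x := by
  by_contra hx
  apply h
  have : x ∈ RingHom.ker (PadicInt.toZMod : ℤ_[2] →+* ZMod 2) := by
    rw [PadicInt.ker_toZMod]; exact hx
  exact this

lemma padic_mat_dvd {a b : Type*} (X : Matrix a b ℤ_[2])
    (h : ∀ i j, PadicInt.toZMod (X i j) = 0) : ∃ Y, X = (2 : ℤ_[2]) • Y := by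
  choose y hy using fun i j => padic_two_dvd (X i j) (h i j)
  exact ⟨of y, by ext i j; simp [hy]⟩

/-- main determinant formula over the 2-adic integers -/
lemma padic_det {n : Type*} [Fintype n] [DecidableEq n] (M K : Matrix n n ℤ_[2])
    (hrel : M + Mᵀ + Mᵀ * (K + Kᵀ) * M = 0) :
    ∃ t : ℤ_[2], (1 + (K + Kᵀ) * M).det
      = (-1) ^ (M.map (PadicInt.toZMod : ℤ_[2] →+* ZMod 2)).rank * (1 + 4 * t) := by
  let φ : ℤ_[2] →+* ZMod 2 := PadicInt.toZMod
  have hφ : Function.Surjective φ := ZMod.ringHom_surjective φ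
  obtain ⟨s, P₀, P₀', h1, h2, h3⟩ := exists_adapted (M.map φ)
  have hl : ∀ x, φ (Function.surjInv hφ x) = x := Function.surjInv_eq hφ
  let P := P₀.map (Function.surjInv hφ)
  let Q := P₀'.map (Function.surjInv hφ)
  have hP : P.map φ = P₀ := by ext i j; simp [P, hl]
  have hQ : Q.map φ = P₀' := by ext i j; simp [Q, hl]
  have hdet : IsUnit (P * Q).det := by
    apply padic_isUnit
    change φ _ ≠ 0
    rw [RingHom.map_det, RingHom.mapMatrix_apply, Matrix.map_mul, hP, hQ, h1, det_one]
    exact one_ne_zero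
  let P' := Q * (P * Q)⁻¹
  have hPP' : P * P' = 1 := by
    rw [← Matrix.mul_assoc, mul_nonsing_inv _ hdet]
  obtain ⟨r1, r2⟩ := wall_rel_congr M K P P' hPP' hrel
  rw [← r2]
  set N := Pᵀ * M * P with hN
  set L := P' * K * P'ᵀ
  have hNφ : N.map φ = P₀ᵀ * (M.map φ * P₀) := by
    rw [hN, Matrix.map_mul, Matrix.map_mul, transpose_map, hP, Matrix.mul_assoc]
  have hcol : ∀ i j, φ (N i (Sum.inr j)) = 0 := by
    intro i j
    have : φ (N i (Sum.inr j)) = (N.map φ) i (Sum.inr j) := rfl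
    rw [this, hNφ, mul_apply]
    exact Finset.sum_eq_zero fun x _ => by rw [h3, mul_zero]
  have hrow : ∀ i j, φ (N (Sum.inr j) i) = 0 := by
    intro i j
    have e := congrArg φ (congrFun (congrFun r1 i) (Sum.inr j))
    rw [Matrix.add_apply, Matrix.add_apply, transpose_apply, mul_apply, map_add, map_add, hcol, map_sum,
      Finset.sum_eq_zero (fun x _ => by rw [map_mul, hcol, mul_zero])] at e
    simpa using e
  obtain ⟨M₂, hM₂⟩ := padic_mat_dvd N.toBlocks₁₂ (fun i j => hcol _ _)
  obtain ⟨M₃, hM₃⟩ := padic_mat_dvd N.toBlocks₂₁ (fun i j => hrow _ _)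
  obtain ⟨M₄, hM₄⟩ := padic_mat_dvd N.toBlocks₂₂ (fun i j => hrow _ _)
  have hu : IsUnit N.toBlocks₁₁.det := by
    apply padic_isUnit
    change φ _ ≠ 0
    rw [RingHom.map_det, RingHom.mapMatrix_apply]
    apply IsUnit.ne_zero
    apply isUnit_det_of_rank
    rw [Fintype.card_fin]
    let B : Matrix (Fin (M.map φ).rank ⊕ Fin s) (Fin (M.map φ).rank) (ZMod 2) := fromRows 1 0
    let D : Matrix (Fin (M.map φ).rank) (Fin (M.map φ).rank ⊕ Fin s) (ZMod 2) := fromCols 1 0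
    let C : Matrix (Fin (M.map φ).rank) (Fin (M.map φ).rank) (ZMod 2) := N.toBlocks₁₁.map φ
    have e1 : M.map φ = P₀'ᵀ * (B * (C * D)) * P₀' := by
      have : B * (C * D) = N.map φ := by
        ext i j
        rcases i with i | i <;> rcases j with j | j <;>
          simp [B, C, D, mul_fromCols, fromRows_mul, hcol, hrow, toBlocks₁₁]
      rw [this, hNφ]
      have ht : P₀'ᵀ * P₀ᵀ = 1 := by rw [← transpose_mul, h1, transpose_one]
      rw [← Matrix.mul_assoc P₀'ᵀ, ht, Matrix.one_mul, Matrix.mul_assoc, h1, Matrix.mul_one]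
    calc (M.map φ).rank = _ := by rw [← e1]
      _ ≤ _ := rank_mul_le_left _ _
      _ ≤ _ := rank_mul_le_right _ _
      _ ≤ _ := rank_mul_le_right _ _
      _ ≤ _ := rank_mul_le_left _ _
  obtain ⟨t, ht⟩ := det_block_core N.toBlocks₁₁ M₂ M₃ M₄ hu L N
    (by rw [← hM₂, ← hM₃, ← hM₄, fromBlocks_toBlocks]) r1
  exact ⟨t, by rw [ht, Fintype.card_fin]⟩
end Helpers

lemma even_symm_decomp {m : ℕ} (G : Matrix (Fin m) (Fin m) ℤ) (hs : G.IsSymm)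
    (he : ∀ x : Fin m → ℤ, 2 ∣ x ⬝ᵥ G.mulVec x) : ∃ K, G = K + Kᵀ := by
  refine ⟨of fun i j => if i < j then G i j else if i = j then G i i / 2 else 0, ?_⟩
  ext i j
  have hsij : G j i = G i j := hs.apply i j
  simp only [Matrix.add_apply, of_apply, transpose_apply]
  rcases lt_trichotomy i j with h | h | h
  · simp [h, h.not_gt, h.ne']
  · subst h
    have := he (Pi.single i 1)
    simp at this
    simp
    omega
  · simp [h, h.not_gt, h.ne', hsij]

/-- Every automorphism `U` of an even unimodular positive definite
lattice `Λ` induces an orthogonal transformation of `(Λ/2Λ, q)`, and composing the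
natural map `Aut(Λ) → O(Λ/2Λ)` with `(−1)^D` (Dickson invariant `D`) gives the
determinant character: `det U = 1 ↔ D(Ū) = 0`.  In particular if all automorphisms
of `Λ` have determinant `+1` then the image of `Aut(Λ)` lies in the kernel of the
Dickson invariant. -/
theorem dickson_vs_determinant {m : ℕ} (Λ : EvenUnimodularLattice m)
    (U : Matrix (Fin m) (Fin m) ℤ) (hU : Uᵀ * Λ.gram * U = Λ.gram) :
    (∀ q : (Fin m → ZMod 2) → ZMod 2,
      (∀ x : Fin m → ℤ, q (Λ.red x) = ((Λ.inner x x / 2 : ℤ) : ZMod 2)) →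
      ∀ x : Fin m → ℤ, q (Λ.red (U.mulVec x)) = q (Λ.red x)) ∧
    (U.det = 1 ↔
      dickson (Matrix.mulVecLin (U.map (Int.cast : ℤ → ZMod 2))) = 0) := by
  constructor
  · intro q hq x
    rw [hq, hq]
    have : Λ.inner (U.mulVec x) (U.mulVec x) = Λ.inner x x := by
      unfold EvenUnimodularLattice.inner
      conv_rhs => rw [← hU]
      rw [← vecMul_transpose U x, ← dotProduct_mulVec, vecMul_transpose]
      simp only [mulVec_mulVec, Matrix.mul_assoc]
    rw [this]
  obtain ⟨K, hK⟩ := even_symm_decomp Λ.gram Λ.symm Λ.even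
  have hdet : IsUnit Λ.gram.det := by rw [Λ.unimodular]; exact isUnit_one
  have hsym : Λ.gramᵀ = Λ.gram := Λ.symm
  generalize Λ.gram = G at *
  have hGi : G⁻¹ * G = 1 := nonsing_inv_mul _ hdet
  have hGi' : G * G⁻¹ = 1 := mul_nonsing_inv _ hdet
  have hsi : G⁻¹ᵀ = G⁻¹ := by rw [transpose_nonsing_inv, hsym]
  -- the even inverse form
  have hL : G⁻¹ * K * G⁻¹ + (G⁻¹ * K * G⁻¹)ᵀ = G⁻¹ := by
    rw [transpose_mul, transpose_mul, hsi, ← Matrix.mul_assoc, ← Matrix.add_mul, ← Matrix.mul_add,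
      ← hK, hGi, Matrix.one_mul]
  set L := G⁻¹ * K * G⁻¹
  let M := G * (U - 1)
  have hM : M + Mᵀ + Mᵀ * (L + Lᵀ) * M = 0 := by
    have e1 : (L + Lᵀ) * M = U - 1 := by
      rw [hL, ← Matrix.mul_assoc, hGi, Matrix.one_mul]
    have e2 : Mᵀ = (Uᵀ - 1) * G := by simp [M, hsym]
    rw [Matrix.mul_assoc, e1, e2]
    have : G * (U - 1) + (Uᵀ - 1) * G + (Uᵀ - 1) * G * (U - 1) = Uᵀ * G * U - G := by noncomm_ring
    rw [show M = G * (U - 1) from rfl, this, hU, sub_self]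
  have hMd : 1 + (L + Lᵀ) * M = U := by
    rw [hL, ← Matrix.mul_assoc, hGi, Matrix.one_mul]; abel
  let ψ : ℤ →+* ℤ_[2] := Int.castRingHom _
  obtain ⟨t, ht⟩ := padic_det (M.map ψ) (L.map ψ) (by
    have := congrArg (fun X : Matrix _ _ ℤ => X.map ψ) hM
    simpa only [Matrix.map_add ψ (map_add ψ), Matrix.map_mul, transpose_map,
      Matrix.map_zero ψ (map_zero ψ)] using this)
  have hd : (1 + (L.map ψ + (L.map ψ)ᵀ) * M.map ψ).det = ((U.det : ℤ) : ℤ_[2]) := by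
    have := congrArg (fun X : Matrix _ _ ℤ => (X.map ψ).det) hMd
    simp only [Matrix.map_add ψ (map_add ψ), Matrix.map_mul, transpose_map,
      Matrix.map_one ψ (map_zero ψ) (map_one ψ)] at this
    rw [this, ← RingHom.mapMatrix_apply, ← RingHom.map_det]; rfl
  rw [hd] at ht
  -- the rank
  let χ : ℤ →+* ZMod 2 := Int.castRingHom _
  have hMM : (M.map ψ).map (PadicInt.toZMod : ℤ_[2] →+* ZMod 2) = M.map χ := by
    ext i j; simp [ψ, χ]
  rw [hMM] at ht
  have hrk : (M.map χ).rank = (U.map χ - 1).rank := by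
    have : M.map χ = G.map χ * (U.map χ - 1) := by
      simp only [M, Matrix.map_mul, Matrix.map_sub χ (map_sub χ),
        Matrix.map_one χ (map_zero χ) (map_one χ)]
    rw [this]
    apply rank_mul_eq_right_of_isUnit_det
    rw [← RingHom.mapMatrix_apply, ← RingHom.map_det]
    exact hdet.map χ
  have hdk : dickson (Matrix.mulVecLin (U.map (Int.cast : ℤ → ZMod 2)))
      = ((U.map χ - 1).rank : ZMod 2) := by
    unfold dickson Matrix.rank
    have : (U.map (Int.cast : ℤ → ZMod 2)).mulVecLin - LinearMap.id = (U.map χ - 1).mulVecLin := by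
      ext1 i
      ext j
      simp [χ]
    rw [this]
  rw [hdk, ← hrk]
  generalize (M.map χ).rank = r at *
  have hUd : U.det = 1 ∨ U.det = -1 := by
    have := congrArg det hU
    rw [det_mul, det_mul, det_transpose] at this
    have h2 : U.det * U.det = 1 := by
      apply hdet.mul_left_cancel
      linear_combination this
    exact mul_self_eq_one_iff.1 h2
  have hno : ∀ t : ℤ_[2], 1 + 2 * t ≠ 0 := by
    intro t h
    have := congrArg (PadicInt.toZMod : ℤ_[2] →+* ZMod 2) h
    rw [map_add, map_mul, map_one, map_zero, map_ofNat, show (OfNat.ofNat 2 : ZMod 2) = 0 from rfl, zero_mul,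
      add_zero] at this
    exact one_ne_zero this
  have h2 : (2 : ℤ_[2]) ≠ 0 := two_ne_zero
  rw [ZMod.natCast_eq_zero_iff_even]
  constructor
  · intro h
    by_contra hr
    rw [Nat.not_even_iff_odd] at hr
    rw [h, hr.neg_one_pow] at ht
    push_cast at ht
    apply hno t
    apply mul_left_cancel₀ h2
    linear_combination ht
  · intro hr
    rcases hUd with h | h
    · exact h
    · rw [h, hr.neg_one_pow] at ht
      push_cast at ht
      exfalso
      apply hno t
      apply mul_left_cancel₀ h2
      linear_combination -ht
end

section
/- Let Λ be the Leech lattice. The sublattices L of Λ isomorphic to D_{12}(2) are in natural bijection with pairs consisting of a frame of Λ together with a choice of 12-element subset of the 24-element set of pairs of the frame. -/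
open Matrix Module

def IsLeech (Λ : EvenUnimodularLattice 24) : Prop :=
  ∀ v : Fin 24 → ℤ, Λ.inner v v ≠ 2

/-- A frame of the Leech lattice: 24 distinct pairs `±v` (48 vectors) of norm-8
vectors, all congruent to each other modulo `2Λ`. -/
def IsFrame (Λ : EvenUnimodularLattice 24) (S : Set (Fin 24 → ℤ)) : Prop :=
  Nat.card S = 48 ∧ (∀ v ∈ S, -v ∈ S) ∧ (∀ v ∈ S, Λ.inner v v = 8) ∧
  (∀ v ∈ S, ∀ u ∈ S, Λ.red v = Λ.red u)

/-- A choice of 12 of the 24 pairs of a frame `S`: a negation-closed subset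
`T ⊆ S` consisting of 12 pairs (24 vectors). -/
def IsHalfFrame (Λ : EvenUnimodularLattice 24) (S T : Set (Fin 24 → ℤ)) : Prop :=
  IsFrame Λ S ∧ T ⊆ S ∧ (∀ v ∈ T, -v ∈ T) ∧ Nat.card T = 24

/-- The sublattice generated by the vectors `(u + v)/2` for distinct non-opposite
`u, v` in the set. -/
def halfSumLattice (T : Set (Fin 24 → ℤ)) : Submodule ℤ (Fin 24 → ℤ) :=
  Submodule.span ℤ {x | ∃ u ∈ T, ∃ v ∈ T, v ≠ u ∧ v ≠ -u ∧ (2 : ℤ) • x = u + v}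

/-- The root lattice `D₁₂ = {x ∈ ℤ¹² : ∑ xᵢ even}` with the standard inner product. -/
def D12 : Submodule ℤ (Fin 12 → ℤ) where
  carrier := {x | (2 : ℤ) ∣ ∑ i, x i}
  add_mem' := by
    intro a b ha hb
    simpa [Finset.sum_add_distrib] using dvd_add ha hb
  zero_mem' := by simp
  smul_mem' := by
    intro c x hx
    simpa [Finset.mul_sum] using Dvd.dvd.mul_left hx c

/-- `N` is a sublattice of `Λ` isomorphic to `D₁₂(2)`, the `D₁₂` root lattice with
all inner products doubled. -/
def IsD12TwoSublattice (Λ : EvenUnimodularLattice 24)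
    (N : Submodule ℤ (Fin 24 → ℤ)) : Prop :=
  ∃ φ : D12 →ₗ[ℤ] (Fin 24 → ℤ), Function.Injective φ ∧ LinearMap.range φ = N ∧
    ∀ x y : D12, Λ.inner (φ x) (φ y) = 2 * ((x : Fin 12 → ℤ) ⬝ᵥ (y : Fin 12 → ℤ))

section Poisson
open MeasureTheory Complex

/-- squared Euclidean norm on `Fin d → ℝ` -/
def ssq {d : ℕ} (x : Fin d → ℝ) : ℝ := ∑ i, x i ^ 2

lemma continuous_ssq {d : ℕ} : Continuous (ssq (d := d)) := by
  unfold ssq; fun_prop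

lemma summable_gauss_one (c : ℝ) (hc : 0 < c) :
    Summable fun n : ℤ => Real.exp (-c * (n : ℝ) ^ 2) := by
  have hg : Summable fun n : ℕ => Real.exp (-c * (n : ℝ) ^ 2) := by
    refine Summable.of_nonneg_of_le (fun _ => (Real.exp_pos _).le) (fun n => ?_)
      (Real.summable_exp_nat_mul_iff.mpr (show -c < 0 by linarith))
    apply Real.exp_le_exp.mpr
    have : (n : ℝ) ≤ (n : ℝ) ^ 2 := by exact_mod_cast Nat.le_self_pow two_ne_zero n
    nlinarith
  apply Summable.of_nat_of_neg
  · simpa using hg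
  · simpa using hg

lemma summable_gauss (d : ℕ) (c : ℝ) (hc : 0 < c) :
    Summable fun n : Fin d → ℤ => Real.exp (-c * ssq (fun i => (n i : ℝ))) := by
  induction d with
  | zero => exact Summable.of_finite
  | succ d ih =>
    rw [← (Fin.consEquiv (fun _ : Fin (d + 1) => ℤ)).summable_iff]
    have := (summable_gauss_one c hc).mul_of_nonneg ih (fun _ => (Real.exp_pos _).le)
      (fun _ => (Real.exp_pos _).le)
    refine this.congr fun p => ?_
    simp only [ssq, Function.comp, Fin.consEquiv_apply, Fin.sum_univ_succ, Fin.cons_zero,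
      Fin.cons_succ]
    rw [← Real.exp_add]; ring_nf

lemma ssq_add_ge {d : ℕ} (x y : Fin d → ℝ) : ssq y / 2 - ssq x ≤ ssq (x + y) := by
  simp only [ssq, Finset.sum_div, ← Finset.sum_sub_distrib]
  apply Finset.sum_le_sum
  intro i _
  simp only [Pi.add_apply]
  nlinarith [sq_nonneg (2 * x i + y i)]

/-- coercion of integer vectors -/
def rv {d : ℕ} (n : Fin d → ℤ) : Fin d → ℝ := fun i => (n i : ℝ)

def toTorus (d : ℕ) : C(Fin d → ℝ, UnitAddTorus (Fin d)) :=
  ⟨fun x i => (x i : UnitAddCircle), by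
    refine continuous_pi fun i => ?_
    exact (AddCircle.continuous_mk' 1).comp (continuous_apply i)⟩

lemma toTorus_isQuotientMap (d : ℕ) : Topology.IsQuotientMap (toTorus d) := by
  have h : IsOpenQuotientMap (Pi.map (fun (_ : Fin d) (x : ℝ) => (x : UnitAddCircle))) :=
    IsOpenQuotientMap.piMap fun i => QuotientAddGroup.isOpenQuotientMap_mk
  exact h.isQuotientMap

lemma gauss_translate_bound {d : ℕ} {f : (Fin d → ℝ) → ℂ} {C c : ℝ} (hC : 0 ≤ C) (hc : 0 < c)
    (hf : ∀ x, ‖f x‖ ≤ C * Real.exp (-c * ssq x)) (R : ℝ) (x : Fin d → ℝ) (hx : ssq x ≤ R)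
    (n : Fin d → ℤ) :
    ‖f (x + rv n)‖ ≤ C * Real.exp (c * R) * Real.exp (-(c / 2) * ssq (fun i => (n i : ℝ))) := by
  refine (hf _).trans ?_
  rw [mul_assoc, ← Real.exp_add]
  gcongr
  have := ssq_add_ge x (rv n)
  unfold rv at *
  nlinarith

lemma continuous_periodization {d : ℕ} {f : (Fin d → ℝ) → ℂ} (hcont : Continuous f) {C c : ℝ}
    (hC : 0 ≤ C) (hc : 0 < c) (hf : ∀ x, ‖f x‖ ≤ C * Real.exp (-c * ssq x)) :
    Continuous fun x => ∑' n : Fin d → ℤ, f (x + rv n) := by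
  rw [continuous_iff_continuousAt]
  intro x₀
  have hU : {x : Fin d → ℝ | ssq x < ssq x₀ + 1} ∈ nhds x₀ :=
    (isOpen_lt continuous_ssq continuous_const).mem_nhds (by simp)
  refine ContinuousOn.continuousAt ?_ hU
  refine continuousOn_tsum (fun n => (hcont.comp (continuous_add_const _)).continuousOn)
    ((summable_gauss d (c / 2) (by positivity)).mul_left (C * Real.exp (c * (ssq x₀ + 1)))) ?_
  intro n x hx
  exact gauss_translate_bound hC hc hf _ x (le_of_lt hx) n

/-- the unit box -/
def ubox (d : ℕ) : Set (Fin d → ℝ) := {x | ∀ i, x i ∈ Set.Ioc (0 : ℝ) (0 + 1)}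

lemma measurableSet_ubox (d : ℕ) : MeasurableSet (ubox d) :=
  MeasurableSet.univ_pi' (fun _ => measurableSet_Ioc)

lemma hasSum_box {d : ℕ} {g : (Fin d → ℝ) → ℂ} (hg : Integrable g) :
    HasSum (fun n : Fin d → ℤ => ∫ x in ubox d, g (x + rv n)) (∫ x, g x) := by
  have hset : ∀ n : Fin d → ℤ, ∫ x in ubox d, g (x + rv n) =
      ∫ x in (fun x => x - rv n) ⁻¹' (ubox d), g x := by
    intro n
    have hm : MeasurableSet ((fun x : Fin d → ℝ => x - rv n) ⁻¹' (ubox d)) :=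
      (measurable_sub_const _) (measurableSet_ubox d)
    rw [← integral_indicator (measurableSet_ubox d), ← integral_indicator hm,
      ← integral_add_right_eq_self (((fun x => x - rv n) ⁻¹' (ubox d)).indicator g) (rv n)]
    congr 1
    ext x
    have h : (x + rv n ∈ (fun x : Fin d → ℝ => x - rv n) ⁻¹' (ubox d)) = (x ∈ ubox d) := by
      change (x + rv n - rv n ∈ ubox d) = _
      rw [add_sub_cancel_right]
    simp only [Set.indicator]
    by_cases hx : x ∈ ubox d
    · rw [if_pos hx, if_pos (h.mpr hx)]
    · rw [if_neg hx, if_neg (fun h' => hx (h.mp h'))]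
  simp_rw [hset]
  have huniv : (⋃ n : Fin d → ℤ, (fun x => x - rv n) ⁻¹' (ubox d)) = Set.univ := by
    rw [Set.eq_univ_iff_forall]
    intro x
    refine Set.mem_iUnion.mpr ⟨fun i => ⌈x i⌉ - 1, fun i => ?_⟩
    simp only [rv, Pi.sub_apply, Set.mem_Ioc]
    push_cast
    constructor <;> linarith [Int.ceil_lt_add_one (x i), Int.le_ceil (x i)]
  have hdisj : Pairwise (Function.onFun Disjoint
      fun n : Fin d → ℤ => (fun x : Fin d → ℝ => x - rv n) ⁻¹' (ubox d)) := by
    intro m n hmn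
    refine Set.disjoint_left.mpr fun x hx hy => hmn ?_
    funext i
    have h1 := hx i
    have h2 := hy i
    simp only [rv, Pi.sub_apply, Set.mem_Ioc] at h1 h2
    have h3 : (m i : ℝ) < n i + 1 := by linarith
    have h4 : (n i : ℝ) < m i + 1 := by linarith
    norm_cast at h3 h4
    omega
  have := hasSum_integral_iUnion (μ := volume) (f := g)
    (s := fun n : Fin d → ℤ => (fun x : Fin d → ℝ => x - rv n) ⁻¹' (ubox d))
    (fun n => (measurable_sub_const _) (measurableSet_ubox d)) hdisj
    (by rw [huniv]; exact hg.integrableOn)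
  rwa [huniv, setIntegral_univ] at this

lemma integrable_gauss_bound {d : ℕ} {f : (Fin d → ℝ) → ℂ} (hcont : Continuous f) {C c : ℝ}
    (hc : 0 < c) (hf : ∀ x, ‖f x‖ ≤ C * Real.exp (-c * ssq x)) :
    Integrable f := by
  have h := GaussianFourier.integrable_cexp_neg_mul_sum_add (b := (c : ℂ)) (by simpa using hc)
    (fun _ : Fin d => (0 : ℂ))
  have h2 := h.norm.const_mul C
  refine h2.mono' hcont.aestronglyMeasurable (Filter.Eventually.of_forall fun x => ?_)
  refine (hf x).trans (le_of_eq ?_)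
  congr 1
  rw [Complex.norm_exp]
  congr 1
  simp only [ssq, zero_mul, Finset.sum_const_zero, add_zero]
  have : (-(c : ℂ) * ∑ i, (x i : ℂ) ^ 2) = ((-c * ∑ i, x i ^ 2 : ℝ) : ℂ) := by push_cast; rfl
  rw [this, Complex.ofReal_re]

lemma mFourier_toTorus {d : ℕ} (k : Fin d → ℤ) (x : Fin d → ℝ) :
    UnitAddTorus.mFourier k (fun i => (x i : UnitAddCircle)) =
      cexp (2 * Real.pi * I * ∑ i, (k i : ℂ) * x i) := by
  simp only [UnitAddTorus.mFourier, ContinuousMap.coe_mk, fourier_coe_apply]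
  rw [← Complex.exp_sum, Finset.mul_sum]
  congr 1
  refine Finset.sum_congr rfl fun i _ => ?_
  push_cast; ring

lemma mFourier_periodic {d : ℕ} (k n : Fin d → ℤ) (x : Fin d → ℝ) :
    UnitAddTorus.mFourier k (fun i => ((x + rv n) i : UnitAddCircle)) =
    UnitAddTorus.mFourier k (fun i => (x i : UnitAddCircle)) := by
  congr 1
  funext i
  simp only [rv, Pi.add_apply]
  rw [AddCircle.coe_add]
  have : ((n i : ℝ) : UnitAddCircle) = 0 := by
    rw [AddCircle.coe_eq_zero_iff]; exact ⟨n i, by simp⟩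
  rw [this, add_zero]

theorem poisson_gauss {d : ℕ} {f : (Fin d → ℝ) → ℂ} (hcont : Continuous f) {C c : ℝ}
    (hC : 0 ≤ C) (hc : 0 < c) (hf : ∀ x, ‖f x‖ ≤ C * Real.exp (-c * ssq x))
    (hsum : Summable fun k : Fin d → ℤ =>
      ∫ x : Fin d → ℝ, cexp (2 * Real.pi * I * ∑ i, ((-k) i : ℂ) * x i) * f x) :
    ∑' n : Fin d → ℤ, f (rv n) = ∑' k : Fin d → ℤ,
      ∫ x : Fin d → ℝ, cexp (2 * Real.pi * I * ∑ i, ((-k) i : ℂ) * x i) * f x := by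
  let G : C(Fin d → ℝ, ℂ) := ⟨_, continuous_periodization hcont hC hc hf⟩
  have hper : ∀ a b, toTorus d a = toTorus d b → G a = G b := by
    intro a b hab
    have : ∃ m : Fin d → ℤ, b = a + rv m := by
      have h1 : ∀ i, ∃ m : ℤ, b i = a i + m := by
        intro i
        have := congrFun hab i
        simp only [toTorus, ContinuousMap.coe_mk] at this
        have h0 : ((b i - a i : ℝ) : UnitAddCircle) = 0 := by
          rw [AddCircle.coe_sub, this, sub_self]
        rw [AddCircle.coe_eq_zero_iff] at h0
        obtain ⟨m, hm⟩ := h0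
        exact ⟨m, by simp at hm; linarith⟩
      choose m hm using h1
      exact ⟨m, funext hm⟩
    obtain ⟨m, rfl⟩ := this
    simp only [G, ContinuousMap.coe_mk]
    rw [← (Equiv.addLeft m).tsum_eq]
    refine tsum_congr fun n => ?_
    congr 1
    funext i
    simp [rv]; ring
  let F : C(UnitAddTorus (Fin d), ℂ) := (toTorus_isQuotientMap d).lift G hper
  have hFG : ∀ x : Fin d → ℝ, F (fun i => (x i : UnitAddCircle)) = ∑' n : Fin d → ℤ, f (x + rv n) := by
    intro x
    have := (toTorus_isQuotientMap d).lift_comp G hper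
    exact DFunLike.congr_fun this x
  have hcoef : ∀ k, UnitAddTorus.mFourierCoeff F k =
      ∫ x : Fin d → ℝ, cexp (2 * Real.pi * I * ∑ i, ((-k) i : ℂ) * x i) * f x := by
    intro k
    rw [UnitAddTorus.mFourierCoeff_eq_integral F k 0]
    set g : (Fin d → ℝ) → ℂ := fun x =>
      UnitAddTorus.mFourier (-k) (fun i => (x i : UnitAddCircle)) * f x with hg
    have hgc : Continuous g :=
      ((UnitAddTorus.mFourier (-k)).continuous.comp (toTorus d).continuous).mul hcont
    have hgb : ∀ x, ‖g x‖ ≤ C * Real.exp (-c * ssq x) := by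
      intro x
      refine le_trans ?_ (hf x)
      rw [hg]
      simp only [norm_mul]
      have h1 : ‖UnitAddTorus.mFourier (-k) (fun i => (x i : UnitAddCircle))‖ ≤ 1 := by
        exact ((UnitAddTorus.mFourier (-k)).norm_coe_le_norm _).trans
          (UnitAddTorus.mFourier_norm (n := -k)).le
      nlinarith [norm_nonneg (f x)]
    have hgi := integrable_gauss_bound hgc hc hgb
    have h1 := hasSum_box hgi
    have h2 := (hasSum_box (g := fun x => (‖g x‖ : ℂ)) hgi.norm.ofReal).summable
    have h3 : HasSum (fun n : Fin d → ℤ => ∫ x in ubox d, g (x + rv n))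
        (∫ x in ubox d, ∑' n : Fin d → ℤ, g (x + rv n)) := by
      apply hasSum_integral_of_summable_integral_norm
      · intro n
        exact (hgi.comp_add_right (rv n)).integrableOn
      · refine Complex.summable_ofReal.mp (h2.congr fun n => ?_)
        exact integral_ofReal (𝕜 := ℂ)
    have h4 := h1.unique h3
    have h5 : (∫ x : Fin d → ℝ, cexp (2 * Real.pi * I * ∑ i, ((-k) i : ℂ) * x i) * f x) =
        ∫ x, g x := by
      refine integral_congr_ae (Filter.Eventually.of_forall fun x => ?_)
      simp only [hg]
      rw [mFourier_toTorus]
    rw [h5, h4]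
    refine setIntegral_congr_fun (measurableSet_ubox d) fun x _ => ?_
    simp only [hg, smul_eq_mul]
    rw [hFG, ← tsum_mul_left]
    refine tsum_congr fun n => ?_
    rw [mFourier_periodic]
  have hs : Summable (UnitAddTorus.mFourierCoeff F) := by
    refine hsum.congr fun k => (hcoef k).symm
  have h0 := (UnitAddTorus.hasSum_mFourier_series_apply_of_summable hs
    (fun i => ((0 : Fin d → ℝ) i : UnitAddCircle))).tsum_eq
  rw [hFG] at h0
  simp only [zero_add] at h0
  rw [← h0]
  refine tsum_congr fun k => ?_
  rw [← hcoef, mFourier_toTorus]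
  simp

end Poisson

section Factor
open scoped MatrixOrder

variable {d : ℕ} (Λ : EvenUnimodularLattice d)

/-- The real Gram matrix. -/
noncomputable def gramR : Matrix (Fin d) (Fin d) ℝ := Λ.gram.map (Int.cast : ℤ → ℝ)

theorem gramR_rv (n k : Fin d → ℤ) : rv n ⬝ᵥ (gramR Λ).mulVec (rv k) = (Λ.inner n k : ℝ) := by
  simp [rv, gramR, EvenUnimodularLattice.inner, dotProduct, mulVec]

theorem gramR_nonneg (x : Fin d → ℝ) : 0 ≤ x ⬝ᵥ (gramR Λ).mulVec x := by
  have hd : DenseRange (fun (q : Fin d → ℚ) (i : Fin d) => (q i : ℝ)) :=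
    DenseRange.piMap (fun _ => Rat.denseRange_cast)
  refine hd.induction_on (p := fun x => 0 ≤ x ⬝ᵥ (gramR Λ).mulVec x) x ?_ ?_
  · refine isClosed_le continuous_const ?_
    simp only [dotProduct, mulVec]
    fun_prop
  · intro q
    obtain ⟨b, hb⟩ := IsLocalization.exist_integer_multiples (nonZeroDivisors ℤ) Finset.univ q
    choose n hn using fun i => hb i (Finset.mem_univ i)
    have hb0 : ((b : ℤ) : ℝ) ≠ 0 := by
      exact_mod_cast nonZeroDivisors.coe_ne_zero b
    have h1 : (fun i => (q i : ℝ)) = ((b : ℤ) : ℝ)⁻¹ • rv n := by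
      funext i
      have := hn i
      simp only [algebraMap_int_eq, eq_intCast, Submonoid.smul_def, zsmul_eq_mul] at this
      have h2 : ((n i : ℤ) : ℝ) = ((b : ℤ) : ℝ) * (q i : ℝ) := by exact_mod_cast congrArg (Rat.cast : ℚ → ℝ) this
      simp [rv, h2, hb0]
    show 0 ≤ (fun i => (q i : ℝ)) ⬝ᵥ (gramR Λ).mulVec (fun i => (q i : ℝ))
    rw [h1, mulVec_smul, dotProduct_smul, smul_dotProduct, gramR_rv, smul_eq_mul, smul_eq_mul,
      ← mul_assoc]
    refine mul_nonneg (mul_self_nonneg _) ?_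
    by_cases h : n = 0
    · simp [h, EvenUnimodularLattice.inner]
    · exact_mod_cast (Λ.posdef n h).le

theorem exists_factor : ∃ B : Matrix (Fin d) (Fin d) ℝ, Bᵀ * B = gramR Λ ∧ |B.det| = 1 := by
  have hps : (gramR Λ).PosSemidef := by
    rw [posSemidef_iff_dotProduct_mulVec]
    refine ⟨?_, fun x => by simpa using gramR_nonneg Λ x⟩
    ext i j
    have := congrFun (congrFun Λ.symm i) j
    simp only [transpose_apply] at this
    simp [gramR, this]
  have h0 : 0 ≤ gramR Λ := nonneg_iff_posSemidef.2 hps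
  obtain ⟨B, hB⟩ := CStarAlgebra.nonneg_iff_eq_star_mul_self.1 h0
  have hB' : Bᵀ * B = gramR Λ := by
    rw [hB, star_eq_conjTranspose, conjTranspose_eq_transpose_of_trivial]
  refine ⟨B, hB', ?_⟩
  have h1 : (gramR Λ).det = 1 := by
    have := (Int.castRingHom ℝ).map_det Λ.gram
    rw [Λ.unimodular] at this
    simpa [gramR, RingHom.mapMatrix] using this.symm
  rw [← hB', det_mul, det_transpose, ← abs_mul_abs_self] at h1
  nlinarith [abs_nonneg B.det]

end Factor

section Theta
open MeasureTheory Complex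

theorem ssq_mulVec_le {d : ℕ} (M : Matrix (Fin d) (Fin d) ℝ) (x : Fin d → ℝ) :
    ssq (M.mulVec x) ≤ (∑ i, ∑ j, M i j ^ 2) * ssq x := by
  unfold ssq
  rw [Finset.sum_mul]
  refine Finset.sum_le_sum fun i _ => ?_
  exact Finset.sum_mul_sq_le_sq_mul_sq Finset.univ (fun j => M i j) x

theorem exists_ssq_lower {d : ℕ} (B : Matrix (Fin d) (Fin d) ℝ) (hB : B.det ≠ 0) :
    ∃ c : ℝ, 0 < c ∧ ∀ x, c * ssq x ≤ ssq (B.mulVec x) := by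
  set K := ∑ i, ∑ j, B⁻¹ i j ^ 2 with hK
  have hK0 : 0 ≤ K := Finset.sum_nonneg fun i _ => Finset.sum_nonneg fun j _ => sq_nonneg _
  refine ⟨(K + 1)⁻¹, by positivity, fun x => ?_⟩
  have h := ssq_mulVec_le B⁻¹ (B.mulVec x)
  rw [mulVec_mulVec, nonsing_inv_mul _ (isUnit_iff_ne_zero.2 hB), one_mulVec, ← hK] at h
  have h2 : 0 ≤ ssq (B.mulVec x) := Finset.sum_nonneg fun i _ => sq_nonneg _
  rw [inv_mul_le_iff₀ (by positivity)]
  nlinarith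

theorem quad_eq {d : ℕ} {Λ : EvenUnimodularLattice d} {B : Matrix (Fin d) (Fin d) ℝ}
    (hB : Bᵀ * B = gramR Λ) (x y : Fin d → ℝ) :
    x ⬝ᵥ (gramR Λ).mulVec y = (B.mulVec x) ⬝ᵥ (B.mulVec y) := by
  rw [← hB, ← mulVec_mulVec, dotProduct_mulVec, vecMul_transpose]

theorem ssq_eq_dot {d : ℕ} (x : Fin d → ℝ) : ssq x = x ⬝ᵥ x := by
  simp [ssq, dotProduct, sq]

/-- change of variables -/
theorem integral_comp_mulVec {d : ℕ} (B : Matrix (Fin d) (Fin d) ℝ) (hB : |B.det| = 1)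
    (g : (Fin d → ℝ) → ℂ) : ∫ x, g (B.mulVec x) = ∫ y, g y := by
  have hdet : B.det ≠ 0 := by intro h; simp [h] at hB
  have hmp : MeasurePreserving (toLin' B) volume volume := by
    refine ⟨?_, ?_⟩
    · exact (LinearMap.continuous_of_finiteDimensional _).measurable
    · rw [Real.map_matrix_volume_pi_eq_smul_volume_pi hdet, abs_inv, hB]; simp
  have hemb : MeasurableEmbedding (toLin' B) := by
    have : Function.Injective (toLin' B) := by
      show Function.Injective B.mulVec
      exact mulVec_injective_iff_isUnit.2 ((isUnit_iff_isUnit_det _).2 (isUnit_iff_ne_zero.2 hdet))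
    exact (LinearMap.continuous_of_finiteDimensional _).measurableEmbedding this
  exact hmp.integral_comp hemb g

theorem gauss_fourier {d : ℕ} {Λ : EvenUnimodularLattice d} {B : Matrix (Fin d) (Fin d) ℝ}
    (hB : Bᵀ * B = gramR Λ) (hdet : |B.det| = 1) (τ : ℂ) (hτ : 0 < τ.im) (m : Fin d → ℤ) :
    ∫ x : Fin d → ℝ, cexp (2 * Real.pi * I * ∑ i, ((-(Λ.gram.mulVec m)) i : ℂ) * x i) *
      cexp (Real.pi * I * τ * (ssq (B.mulVec x) : ℝ)) =
    (I / τ) ^ ((d : ℂ) / 2) * cexp (Real.pi * I * (-1 / τ) * (Λ.inner m m : ℂ)) := by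
  have hτ0 : τ ≠ 0 := by rintro rfl; simp at hτ
  have hre : 0 < (-(Real.pi * I * τ)).re := by
    simp; positivity
  have hpi : (Real.pi : ℂ) ≠ 0 := by exact_mod_cast Real.pi_ne_zero
  have key := GaussianFourier.integral_cexp_neg_mul_sum_add hre
    (fun i => -2 * Real.pi * I * ((B.mulVec (rv m)) i : ℂ))
  rw [← integral_comp_mulVec B hdet] at key
  convert! key using 1
  · congr 1
    funext x
    rw [← Complex.exp_add]
    congr 1
    have e1 : ∑ i, ((-(Λ.gram.mulVec m)) i : ℂ) * x i =
        -((B.mulVec (rv m) ⬝ᵥ B.mulVec x : ℝ) : ℂ) := by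
      rw [← quad_eq hB, dotProduct_comm, ]
      have : gramR Λ *ᵥ x ⬝ᵥ rv m = gramR Λ *ᵥ rv m ⬝ᵥ x := by
        rw [dotProduct_comm, quad_eq hB, dotProduct_comm, ← quad_eq hB, dotProduct_comm]
      rw [this]
      simp [dotProduct, mulVec, gramR, rv]
    rw [e1]
    simp only [ssq, dotProduct]
    push_cast
    simp only [mul_assoc, ← Finset.mul_sum]
    ring
  · congr 1
    · rw [Fintype.card_fin]
      congr 1
      field_simp
      simp
    · congr 1
      have : (Λ.inner m m : ℂ) = ∑ i, ((B.mulVec (rv m)) i : ℂ) ^ 2 := by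
        have := gramR_rv Λ m m
        rw [quad_eq hB, ← ssq_eq_dot, ssq] at this
        exact_mod_cast this.symm
      rw [this]
      simp only [mul_pow, ← Finset.mul_sum]
      field_simp
      norm_num [mul_comm]

/-- The theta function. -/
noncomputable def theta {d : ℕ} (Λ : EvenUnimodularLattice d) (τ : ℂ) : ℂ :=
  ∑' n : Fin d → ℤ, cexp (Real.pi * I * τ * (Λ.inner n n : ℂ))

theorem norm_theta_term {d : ℕ} (Λ : EvenUnimodularLattice d) (τ : ℂ) (n : Fin d → ℤ) :
    ‖cexp (Real.pi * I * τ * (Λ.inner n n : ℂ))‖ = Real.exp (-(Real.pi * τ.im) * Λ.inner n n) := by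
  rw [Complex.norm_exp]
  congr 1
  simp

theorem exists_inner_lower {d : ℕ} (Λ : EvenUnimodularLattice d) :
    ∃ c : ℝ, 0 < c ∧ ∀ n : Fin d → ℤ, c * ssq (rv n) ≤ Λ.inner n n := by
  obtain ⟨B, hB, hdet⟩ := exists_factor Λ
  obtain ⟨c, hc, h⟩ := exists_ssq_lower B (by intro h; simp [h] at hdet)
  refine ⟨c, hc, fun n => ?_⟩
  rw [← gramR_rv, quad_eq hB, ← ssq_eq_dot]
  exact h _

theorem summable_theta_real {d : ℕ} (Λ : EvenUnimodularLattice d) (t : ℝ) (ht : 0 < t) :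
    Summable fun n : Fin d → ℤ => Real.exp (-t * Λ.inner n n) := by
  obtain ⟨c, hc, h⟩ := exists_inner_lower Λ
  refine Summable.of_nonneg_of_le (fun _ => (Real.exp_pos _).le) (fun n => ?_)
    (summable_gauss d (t * c) (by positivity))
  refine Real.exp_le_exp.2 ?_
  have := mul_le_mul_of_nonneg_left (h n) ht.le
  show -t * (Λ.inner n n : ℝ) ≤ -(t * c) * ssq (rv n)
  linarith

theorem summable_theta {d : ℕ} (Λ : EvenUnimodularLattice d) (τ : ℂ) (hτ : 0 < τ.im) :
    Summable fun n : Fin d → ℤ => cexp (Real.pi * I * τ * (Λ.inner n n : ℂ)) := by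
  refine Summable.of_norm ?_
  simp only [norm_theta_term]
  exact summable_theta_real Λ _ (by positivity)

/-- reindexing by the Gram matrix -/
noncomputable def gramEquiv {d : ℕ} (Λ : EvenUnimodularLattice d) : (Fin d → ℤ) ≃ (Fin d → ℤ) where
  toFun := Λ.gram.mulVec
  invFun := Λ.gram⁻¹.mulVec
  left_inv x := by
    rw [mulVec_mulVec, nonsing_inv_mul _ (by simp [Λ.unimodular]), one_mulVec]
  right_inv x := by
    rw [mulVec_mulVec, mul_nonsing_inv _ (by simp [Λ.unimodular]), one_mulVec]

theorem im_neg_inv_pos (τ : ℂ) (hτ : 0 < τ.im) : 0 < (-1 / τ).im := by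
  have hτ0 : τ ≠ 0 := by rintro rfl; simp at hτ
  have : (-1 / τ).im = τ.im / Complex.normSq τ := by
    rw [neg_div, Complex.neg_im, one_div, Complex.inv_im]; ring
  rw [this]
  exact div_pos hτ (Complex.normSq_pos.2 hτ0)

theorem theta_transform {d : ℕ} (Λ : EvenUnimodularLattice d) (τ : ℂ) (hτ : 0 < τ.im) :
    theta Λ τ = (I / τ) ^ ((d : ℂ) / 2) * theta Λ (-1 / τ) := by
  obtain ⟨B, hB, hdet⟩ := exists_factor Λ
  obtain ⟨c, hc, h⟩ := exists_ssq_lower B (by intro h; simp [h] at hdet)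
  have hgf := gauss_fourier hB hdet τ hτ
  have P := poisson_gauss (d := d) (f := fun x => cexp (Real.pi * I * τ * (ssq (B.mulVec x) : ℝ)))
    (C := 1) (c := Real.pi * τ.im * c) ?_ zero_le_one (by positivity) ?_ ?_
  · rw [theta, theta, ← tsum_mul_left]
    refine Eq.trans ?_ (P.trans ?_)
    · congr 1
      funext n
      rw [ssq_eq_dot, ← quad_eq hB, gramR_rv]
      norm_cast
    · rw [← (gramEquiv Λ).tsum_eq]
      exact tsum_congr hgf
  · have := continuous_ssq (d := d)
    have h2 : Continuous fun x : Fin d → ℝ => B.mulVec x := by fun_prop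
    have h3 := this.comp h2
    simp only [Function.comp_def] at h3
    fun_prop
  · intro x
    rw [Complex.norm_exp, one_mul]
    refine Real.exp_le_exp.2 ?_
    have e : (Real.pi * I * τ * (ssq (B.mulVec x) : ℝ)).re = -(Real.pi * τ.im * ssq (B.mulVec x)) := by
      simp
    rw [e]
    have := mul_le_mul_of_nonneg_left (h x) (show 0 ≤ Real.pi * τ.im by positivity)
    linarith
  · rw [← (gramEquiv Λ).summable_iff]
    have := (summable_theta Λ (-1 / τ) (im_neg_inv_pos τ hτ)).mul_left ((I / τ) ^ ((d : ℂ) / 2))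
    convert! this using 1
    funext m
    exact hgf m

end Theta

section ThetaForm
open Complex SlashInvariantForm MatrixGroups ModularForm
open UpperHalfPlane hiding I

/-- half norm -/
def hnorm {d : ℕ} (Λ : EvenUnimodularLattice d) (n : Fin d → ℤ) : ℕ := (Λ.inner n n / 2).toNat

theorem inner_self_nonneg' {d : ℕ} (Λ : EvenUnimodularLattice d) (n : Fin d → ℤ) :
    0 ≤ Λ.inner n n := by
  by_cases h : n = 0
  · simp [h, EvenUnimodularLattice.inner]
  · exact (Λ.posdef n h).le

theorem inner_eq_hnorm {d : ℕ} (Λ : EvenUnimodularLattice d) (n : Fin d → ℤ) :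
    Λ.inner n n = 2 * (hnorm Λ n : ℤ) := by
  have h1 := inner_self_nonneg' Λ n
  have h2 : (2 : ℤ) ∣ Λ.inner n n := Λ.even n
  unfold hnorm
  omega

/-- The number of vectors with norm `2 * k`. -/
noncomputable def cnt {d : ℕ} (Λ : EvenUnimodularLattice d) (k : ℕ) : ℕ :=
  Nat.card (hnorm Λ ⁻¹' {k})

theorem hasSum_theta {d : ℕ} (Λ : EvenUnimodularLattice d) (τ : ℍ) :
    HasSum (fun k : ℕ => (cnt Λ k : ℂ) • Function.Periodic.qParam 1 τ ^ k) (theta Λ τ) := by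
  have h := (summable_theta Λ τ τ.im_pos).hasSum.tsum_fiberwise (hnorm Λ)
  convert! h using 1
  funext k
  have : ∀ b : hnorm Λ ⁻¹' {k}, cexp (Real.pi * I * τ * (Λ.inner b.1 b.1 : ℂ)) =
      Function.Periodic.qParam 1 τ ^ k := by
    intro b
    have hb : hnorm Λ b.1 = k := b.2
    rw [inner_eq_hnorm, hb, Function.Periodic.qParam, ← Complex.exp_nat_mul]
    congr 1
    push_cast
    ring
  rw [tsum_congr this, tsum_const, cnt]
  simp

theorem differentiableOn_theta {d : ℕ} (Λ : EvenUnimodularLattice d) :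
    DifferentiableOn ℂ (theta Λ) {z | 0 < z.im} := by
  intro z hz
  have hz' : 0 < z.im := hz
  have h : DifferentiableOn ℂ (theta Λ) {w | z.im / 2 < w.im} := by
    refine Complex.differentiableOn_tsum_of_summable_norm
      (summable_theta_real Λ (Real.pi * (z.im / 2)) (by positivity)) ?_
      (isOpen_lt continuous_const Complex.continuous_im) ?_
    · intro n
      fun_prop
    · intro n w hw
      rw [norm_theta_term]
      refine Real.exp_le_exp.2 ?_
      have h0 : (0 : ℝ) ≤ Λ.inner n n := by exact_mod_cast inner_self_nonneg' Λ n
      have hw' : z.im / 2 < w.im := hw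
      have := mul_le_mul_of_nonneg_right (mul_le_mul_of_nonneg_left hw'.le Real.pi_pos.le) h0
      linarith
  exact (h.differentiableAt ((isOpen_lt continuous_const Complex.continuous_im).mem_nhds
    (by simp; linarith))).differentiableWithinAt

/-- theta on the upper half plane -/
noncomputable def thetaH {d : ℕ} (Λ : EvenUnimodularLattice d) (τ : ℍ) : ℂ := theta Λ τ

theorem thetaH_T (Λ : EvenUnimodularLattice 24) : (thetaH Λ ∣[(12 : ℤ)] ModularGroup.T) = thetaH Λ := by
  ext z
  have hd : denom ModularGroup.T z = 1 := by
    rw [ModularGroup.denom_apply]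
    simp [ModularGroup.T]
  rw [ModularForm.SL_slash_apply, modular_T_smul, hd]
  simp only [thetaH, theta, _root_.one_zpow, mul_one]
  refine tsum_congr fun n => ?_
  rw [coe_vadd, inner_eq_hnorm, Complex.exp_eq_exp_iff_exists_int]
  refine ⟨hnorm Λ n, ?_⟩
  push_cast
  ring

theorem thetaH_S (Λ : EvenUnimodularLattice 24) : (thetaH Λ ∣[(12 : ℤ)] ModularGroup.S) = thetaH Λ := by
  ext z
  suffices theta Λ (-(↑z)⁻¹) * ((z : ℂ) ^ 12)⁻¹ = theta Λ z by
    rw [ModularForm.SL_slash_apply, UpperHalfPlane.modular_S_smul, ModularGroup.denom_S]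
    simpa [thetaH]
  have hz : (z : ℂ) ≠ 0 := ne_zero z
  rw [theta_transform Λ z z.im_pos]
  have : ((24 : ℕ) : ℂ) / 2 = (12 : ℕ) := by norm_num
  rw [this, Complex.cpow_natCast, div_pow, neg_div, one_div]
  have hI : I ^ 12 = 1 := by
    rw [show 12 = 4 * 3 by norm_num, pow_mul, Complex.I_pow_four, one_pow]
  rw [hI]
  ring

/-- theta as a modular form -/
noncomputable def thetaForm (Λ : EvenUnimodularLattice 24) : ModularForm 𝒮ℒ 12 where
  toFun := thetaH Λ
  slash_action_eq' A hA := by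
    obtain ⟨A, rfl⟩ := hA
    exact slash_action_generators_SL2Z (thetaH_S Λ) (thetaH_T Λ) A
  holo' := by
    rw [UpperHalfPlane.mdifferentiable_iff]
    refine (differentiableOn_theta Λ).congr fun z hz ↦ ?_
    simp [thetaH, ofComplex_apply_of_im_pos hz]
  bdd_at_cusps' hc := by
    rw [Subgroup.IsArithmetic.isCusp_iff_isCusp_SL2Z] at hc
    rw [OnePoint.isBoundedAt_iff_forall_SL2Z hc]
    intro γ _
    rw [slash_action_generators_SL2Z (thetaH_S Λ) (thetaH_T Λ)]
    exact isBoundedAtImInfty_of_hasSum_qExpansion one_pos (hasSum_theta Λ)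

theorem thetaForm_coeff (Λ : EvenUnimodularLattice 24) (k : ℕ) :
    (qExpansion 1 (thetaForm Λ)).coeff k = cnt Λ k :=
  (ModularFormClass.qExpansion_coeff_unique one_pos one_mem_strictPeriods_SL
    (f := thetaForm Λ) (hasSum_theta Λ) k).symm

end ThetaForm

section Coeff
open Complex ModularForm MatrixGroups EisensteinSeries
open UpperHalfPlane hiding I

/-- The form `7/12 E₄³ + 5/12 E₆²`. -/
noncomputable def candForm : ModularForm 𝒮ℒ 12 :=
  (7 / 12 : ℂ) • ModularForm.mcast (by decide) (E₄.pow 3) +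
    (5 / 12 : ℂ) • ModularForm.mcast (by decide) (E₆.pow 2)

theorem candForm_q : qExpansion 1 candForm =
    (7 / 12 : ℂ) • (qExpansion 1 E₄ * qExpansion 1 E₄ * qExpansion 1 E₄) +
      (5 / 12 : ℂ) • (qExpansion 1 E₆ * qExpansion 1 E₆) := by
  set f : ModularForm 𝒮ℒ 12 := ModularForm.mcast (by decide) (E₄.pow 3) with hf
  set g : ModularForm 𝒮ℒ 12 := ModularForm.mcast (by decide) (E₆.pow 2) with hg
  have h1 : (candForm : ℍ → ℂ) = ((7 / 12 : ℂ) • f : ModularForm 𝒮ℒ 12) + ((5 / 12 : ℂ) • g : ModularForm 𝒮ℒ 12) := rfl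
  have h2 : (((7 / 12 : ℂ) • f : ModularForm 𝒮ℒ 12) : ℍ → ℂ) = (7 / 12 : ℂ) • (f : ℍ → ℂ) := rfl
  have h3 : (((5 / 12 : ℂ) • g : ModularForm 𝒮ℒ 12) : ℍ → ℂ) = (5 / 12 : ℂ) • (g : ℍ → ℂ) := rfl
  rw [h1, ModularForm.qExpansion_add one_pos one_mem_strictPeriods_SL, h2, h3,
    ModularForm.qExpansion_smul one_pos one_mem_strictPeriods_SL,
    ModularForm.qExpansion_smul one_pos one_mem_strictPeriods_SL, hf, hg, coe_mcast, coe_mcast,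
    ModularForm.qExpansion_pow one_pos one_mem_strictPeriods_SL,
    ModularForm.qExpansion_pow one_pos one_mem_strictPeriods_SL, pow_succ, pow_two, pow_two]

theorem e4c : (qExpansion 1 E₄).coeff 2 = 2160 ∧ (qExpansion 1 E₄).coeff 3 = 6720 ∧
    (qExpansion 1 E₄).coeff 4 = 17520 := by
  have h2 : ArithmeticFunction.sigma 3 2 = 9 := by decide +kernel
  have h3 : ArithmeticFunction.sigma 3 3 = 28 := by decide +kernel
  have h4 : ArithmeticFunction.sigma 3 4 = 73 := by decide +kernel
  norm_num [E_qExpansion_coeff _ ⟨2, rfl⟩, show bernoulli 4 = -1 / 30 by decide +kernel, h2, h3, h4]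

theorem e6c : (qExpansion 1 E₆).coeff 2 = -16632 ∧ (qExpansion 1 E₆).coeff 3 = -122976 ∧
    (qExpansion 1 E₆).coeff 4 = -532728 := by
  have h2 : ArithmeticFunction.sigma 5 2 = 33 := by decide +kernel
  have h3 : ArithmeticFunction.sigma 5 3 = 244 := by decide +kernel
  have h4 : ArithmeticFunction.sigma 5 4 = 1057 := by decide +kernel
  norm_num [E_qExpansion_coeff _ ⟨3, rfl⟩, show bernoulli 6 = 1 / 42 by decide +kernel, h2, h3, h4]

theorem candForm_coeffs : (qExpansion 1 candForm).coeff 0 = 1 ∧ (qExpansion 1 candForm).coeff 1 = 0 ∧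
    (qExpansion 1 candForm).coeff 2 = 196560 ∧ (qExpansion 1 candForm).coeff 3 = 16773120 ∧
    (qExpansion 1 candForm).coeff 4 = 398034000 := by
  obtain ⟨a2, a3, a4⟩ := e4c
  obtain ⟨b2, b3, b4⟩ := e6c
  rw [candForm_q]
  norm_num [PowerSeries.coeff_mul, Finset.Nat.antidiagonal_succ, E₄_qExpansion_coeff_one,
    E₆_qExpansion_coeff_one, E_qExpansion_coeff_zero _ ⟨2, rfl⟩,
    E_qExpansion_coeff_zero _ ⟨3, rfl⟩, a2, a3, a4, b2, b3, b4, -PowerSeries.coeff_zero_eq_constantCoeff]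

theorem hnorm_eq_zero {d : ℕ} (Λ : EvenUnimodularLattice d) (n : Fin d → ℤ) :
    hnorm Λ n = 0 ↔ n = 0 := by
  constructor
  · intro h
    by_contra hn
    have := Λ.posdef n hn
    have h2 := inner_eq_hnorm Λ n
    unfold EvenUnimodularLattice.inner at h2
    rw [h2, h] at this
    simp at this
  · rintro rfl
    simp [hnorm, EvenUnimodularLattice.inner]

theorem cnt_zero (Λ : EvenUnimodularLattice 24) : cnt Λ 0 = 1 := by
  have : hnorm Λ ⁻¹' {0} = {0} := by
    ext n
    simp [hnorm_eq_zero]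
  rw [cnt, this]
  simp

theorem cnt_one (Λ : EvenUnimodularLattice 24) (hΛ : IsLeech Λ) : cnt Λ 1 = 0 := by
  have : hnorm Λ ⁻¹' {1} = ∅ := by
    ext n
    simp only [Set.mem_preimage, Set.mem_singleton_iff, Set.mem_empty_iff_false, iff_false]
    intro h
    exact hΛ n (by rw [inner_eq_hnorm, h]; rfl)
  rw [cnt, this]
  simp

theorem theta_eq_cand (Λ : EvenUnimodularLattice 24) (hΛ : IsLeech Λ) : thetaForm Λ = candForm := by
  rw [← sub_eq_zero]
  apply ModularForm.sturm_bound_levelOne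
  obtain ⟨a0, a1, -⟩ := candForm_coeffs
  have h : (2 : ℕ∞) ≤ (qExpansion 1 (thetaForm Λ - candForm)).order := by
    refine PowerSeries.nat_le_order _ 2 fun i hi => ?_
    rw [ModularForm.qExpansion_sub one_pos one_mem_strictPeriods_SL, map_sub, thetaForm_coeff]
    interval_cases i
    · rw [a0, cnt_zero]; simp
    · rw [a1, cnt_one Λ hΛ]; simp
  exact lt_of_lt_of_le (by exact_mod_cast (by decide : Int.toNat 12 / 12 < 2)) h

theorem cnts (Λ : EvenUnimodularLattice 24) (hΛ : IsLeech Λ) :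
    cnt Λ 2 = 196560 ∧ cnt Λ 3 = 16773120 ∧ cnt Λ 4 = 398034000 := by
  obtain ⟨-, -, a2, a3, a4⟩ := candForm_coeffs
  rw [← theta_eq_cand Λ hΛ, thetaForm_coeff] at a2 a3 a4
  exact ⟨by exact_mod_cast a2, by exact_mod_cast a3, by exact_mod_cast a4⟩

end Coeff

section Counting

namespace EvenUnimodularLattice
variable {d : ℕ} (Λ : EvenUnimodularLattice d)

theorem inner_comm (x y : Fin d → ℤ) : Λ.inner x y = Λ.inner y x := by
  unfold inner
  rw [dotProduct_mulVec, ← mulVec_transpose, Λ.symm.eq, dotProduct_comm]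

theorem inner_add_left (x y z : Fin d → ℤ) : Λ.inner (x + y) z = Λ.inner x z + Λ.inner y z := by
  simp [inner, add_dotProduct]

theorem inner_add_right (x y z : Fin d → ℤ) : Λ.inner x (y + z) = Λ.inner x y + Λ.inner x z := by
  simp [inner, mulVec_add, dotProduct_add]

theorem inner_neg_left (x z : Fin d → ℤ) : Λ.inner (-x) z = -Λ.inner x z := by
  simp [inner]

theorem inner_neg_right (x z : Fin d → ℤ) : Λ.inner x (-z) = -Λ.inner x z := by
  simp [inner, mulVec_neg]

theorem inner_smul_left (c : ℤ) (x z : Fin d → ℤ) : Λ.inner (c • x) z = c * Λ.inner x z := by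
  simp only [inner, smul_dotProduct, smul_eq_mul]

theorem inner_smul_right (c : ℤ) (x z : Fin d → ℤ) : Λ.inner x (c • z) = c * Λ.inner x z := by
  simp only [inner, mulVec_smul, dotProduct_smul, smul_eq_mul]

theorem inner_sum_left {ι : Type*} (s : Finset ι) (f : ι → Fin d → ℤ) (z : Fin d → ℤ) :
    Λ.inner (∑ i ∈ s, f i) z = ∑ i ∈ s, Λ.inner (f i) z := by
  simp [inner, sum_dotProduct]

theorem inner_sum_right {ι : Type*} (s : Finset ι) (f : ι → Fin d → ℤ) (z : Fin d → ℤ) :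
    Λ.inner z (∑ i ∈ s, f i) = ∑ i ∈ s, Λ.inner z (f i) := by
  rw [inner_comm, inner_sum_left]
  exact Finset.sum_congr rfl fun i _ => Λ.inner_comm _ _

theorem red_eq_iff (x y : Fin d → ℤ) : Λ.red x = Λ.red y ↔ ∃ z, x = y + (2 : ℤ) • z := by
  constructor
  · intro h
    have h1 : ∀ i, ∃ z : ℤ, x i = y i + 2 * z := by
      intro i
      have := congrFun h i
      simp only [red] at this
      rw [ZMod.intCast_eq_intCast_iff_dvd_sub] at this
      obtain ⟨z, hz⟩ := this
      exact ⟨-z, by push_cast at hz; linarith⟩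
    choose z hz using h1
    exact ⟨z, funext fun i => by simp [hz i]⟩
  · rintro ⟨z, rfl⟩
    funext i
    have : (2 : ZMod 2) = 0 := by decide
    simp [red, this]

end EvenUnimodularLattice

variable (Λ : EvenUnimodularLattice 24)

theorem four_le (hΛ : IsLeech Λ) (x : Fin 24 → ℤ) (hx : x ≠ 0) : 4 ≤ Λ.inner x x := by
  have h1 : 0 < Λ.inner x x := Λ.posdef x hx
  have h2 : (2 : ℤ) ∣ Λ.inner x x := Λ.even x
  have h3 := hΛ x
  omega

theorem cong_lemma (hΛ : IsLeech Λ) (x y : Fin 24 → ℤ) (hx : Λ.inner x x ≤ 8) (hy : Λ.inner y y ≤ 8)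
    (h : Λ.red x = Λ.red y) (h1 : x ≠ y) (h2 : x ≠ -y) :
    Λ.inner x x = 8 ∧ Λ.inner y y = 8 ∧ Λ.inner x y = 0 := by
  obtain ⟨z, rfl⟩ := (Λ.red_eq_iff _ _).1 h
  have hz : z ≠ 0 := by rintro rfl; simp at h1
  have hw : y + z ≠ 0 := by
    intro hw
    have : z = -y := by rw [← sub_eq_zero, sub_neg_eq_add, add_comm]; exact hw
    apply h2
    rw [this]
    module
  have a1 := four_le Λ hΛ z hz
  have a2 := four_le Λ hΛ _ hw
  simp only [Λ.inner_add_left, Λ.inner_add_right, Λ.inner_smul_left, Λ.inner_smul_right,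
    Λ.inner_comm z y] at *
  omega

theorem ortho_card (P : Finset (Fin 24 → ℤ)) (h8 : ∀ x ∈ P, Λ.inner x x = 8)
    (ho : ∀ x ∈ P, ∀ y ∈ P, x ≠ y → Λ.inner x y = 0) : P.card ≤ 24 := by
  have hli : LinearIndependent ℤ (fun v : P => v.1) := by
    rw [Fintype.linearIndependent_iff]
    intro g hg j
    have h := congrArg (fun t => Λ.inner t j.1) hg
    simp only [Λ.inner_sum_left, Λ.inner_smul_left] at h
    rw [Finset.sum_eq_single j] at h
    · rw [h8 _ j.2] at h
      simpa [EvenUnimodularLattice.inner] using h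
    · intro b _ hb
      rw [ho _ b.2 _ j.2 (fun e => hb (Subtype.ext e)), mul_zero]
    · simp
  have := hli.fintype_card_le_finrank
  simpa using this

theorem class_card (hΛ : IsLeech Λ) (S : Finset (Fin 24 → ℤ)) (h8 : ∀ x ∈ S, Λ.inner x x = 8)
    (hc : ∀ x ∈ S, ∀ y ∈ S, Λ.red x = Λ.red y) : S.card ≤ 48 := by
  classical
  have ho : ∀ x ∈ S, ∀ y ∈ S, x ≠ y → x ≠ -y → Λ.inner x y = 0 := fun x hx y hy h1 h2 =>
    (cong_lemma Λ hΛ x y (h8 x hx).le (h8 y hy).le (hc x hx y hy) h1 h2).2.2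
  have hP := ortho_card Λ (S.filter fun v => 0 < toLex v)
    (fun x hx => h8 x (Finset.mem_filter.1 hx).1) (fun x hx y hy hxy => by
      rw [Finset.mem_filter] at hx hy
      refine ho x hx.1 y hy.1 hxy ?_
      rintro rfl
      have h1 := hx.2
      have h2 := hy.2
      rw [toLex_neg] at h1
      exact absurd h2 (not_lt.2 (neg_pos.1 h1).le))
  have hN := ortho_card Λ (S.filter fun v => ¬ 0 < toLex v)
    (fun x hx => h8 x (Finset.mem_filter.1 hx).1) (fun x hx y hy hxy => by
      rw [Finset.mem_filter] at hx hy
      refine ho x hx.1 y hy.1 hxy ?_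
      rintro rfl
      have h1 := not_lt.1 hx.2
      have h2 := not_lt.1 hy.2
      rw [toLex_neg] at h1
      have h3 : toLex y = 0 := le_antisymm h2 (neg_nonpos.1 h1)
      have h4 : y = 0 := h3
      have := h8 y hy.1
      rw [h4] at this
      simp [EvenUnimodularLattice.inner] at this)
  have := Finset.card_filter_add_card_filter_not (s := S) (fun v => 0 < toLex v)
  omega

theorem finite_short : {x : Fin 24 → ℤ | Λ.inner x x ≤ 8}.Finite := by
  have h := (summable_theta_real Λ 1 one_pos).tendsto_cofinite_zero.eventually
    (gt_mem_nhds (Real.exp_pos (-9)))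
  rw [Filter.eventually_cofinite] at h
  refine h.subset fun x hx => ?_
  have hx' : Λ.inner x x ≤ 8 := hx
  have hx2 : (Λ.inner x x : ℝ) ≤ 8 := by exact_mod_cast hx'
  simp only [Set.mem_ofPred_eq, not_lt]
  exact Real.exp_le_exp.2 (by linarith)

/-- weights -/
def wt (x : Fin 24 → ℤ) : ℕ :=
  if hnorm Λ x = 0 then 48 else if hnorm Λ x = 4 then 1 else 24

theorem total_weight (hΛ : IsLeech Λ) : ∑ x ∈ (finite_short Λ).toFinset, wt Λ x = 48 * 2 ^ 24 := by
  classical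
  set X := (finite_short Λ).toFinset with hX
  have hm : ∀ x, x ∈ X ↔ hnorm Λ x ≤ 4 := by
    intro x
    rw [hX, Set.Finite.mem_toFinset, Set.mem_ofPred_eq, inner_eq_hnorm]
    omega
  have hc : ∀ k ≤ 4, (X.filter fun x => hnorm Λ x = k).card = cnt Λ k := by
    intro k hk
    have : hnorm Λ ⁻¹' {k} = (X.filter fun x => hnorm Λ x = k : Finset _) := by
      ext x
      simp only [Set.mem_preimage, Set.mem_singleton_iff, Finset.coe_filter, Set.mem_ofPred_eq, hm]
      omega
    rw [cnt, this]
    simp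
  rw [← Finset.sum_fiberwise_of_maps_to (s := X) (t := Finset.range 5) (g := hnorm Λ)
    (fun x hx => by have := (hm x).1 hx; simp; omega)]
  have hs : ∀ k ∈ Finset.range 5, ∑ x ∈ X with hnorm Λ x = k, wt Λ x =
      cnt Λ k * (if k = 0 then 48 else if k = 4 then 1 else 24) := by
    intro k hk
    rw [← hc k (by simp at hk; omega)]
    rw [← smul_eq_mul, ← Finset.sum_const]
    refine Finset.sum_congr rfl fun x hx => ?_
    rw [wt, (Finset.mem_filter.1 hx).2]
  rw [Finset.sum_congr rfl hs]
  obtain ⟨c2, c3, c4⟩ := cnts Λ hΛ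
  simp [Finset.sum_range_succ, c2, c3, c4, cnt_zero, cnt_one Λ hΛ]

theorem fiber_le (hΛ : IsLeech Λ) (c : Fin 24 → ZMod 2) :
    ∑ x ∈ (finite_short Λ).toFinset with Λ.red x = c, wt Λ x ≤ 48 := by
  classical
  set F := (finite_short Λ).toFinset.filter fun x => Λ.red x = c with hF
  have hm : ∀ x, x ∈ F ↔ Λ.inner x x ≤ 8 ∧ Λ.red x = c := by
    intro x
    simp [hF]
  by_cases h : ∀ x ∈ F, Λ.inner x x = 8
  · have : ∀ x ∈ F, wt Λ x = 1 := by
      intro x hx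
      have h1 := h x hx
      rw [inner_eq_hnorm] at h1
      have : hnorm Λ x = 4 := by omega
      simp [wt, this]
    rw [Finset.sum_congr rfl this]
    simp only [Finset.sum_const, smul_eq_mul, mul_one]
    exact class_card Λ hΛ F h fun x hx y hy => by rw [((hm x).1 hx).2, ((hm y).1 hy).2]
  · push Not at h
    obtain ⟨x, hx, hx8⟩ := h
    have hsub : F ⊆ {x, -x} := by
      intro y hy
      simp only [Finset.mem_insert, Finset.mem_singleton]
      by_contra hne
      push Not at hne
      have hx1 := (hm x).1 hx
      have hy1 := (hm y).1 hy
      exact hx8 (cong_lemma Λ hΛ y x hy1.1 hx1.1 (by rw [hx1.2, hy1.2]) hne.1 hne.2).2.1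
    refine (Finset.sum_le_sum_of_subset hsub).trans ?_
    by_cases h0 : x = 0
    · subst h0
      simp [wt]
      split_ifs <;> omega
    · have hw : ∀ y, y ≠ 0 → wt Λ y ≤ 24 := by
        intro y hy
        rw [wt, if_neg (by rwa [hnorm_eq_zero])]
        split_ifs <;> omega
      have hne : x ≠ -x := by
        intro h
        apply h0
        funext i
        have := congrFun h i
        simp at this ⊢
        omega
      rw [Finset.sum_pair hne]
      have := hw x h0
      have := hw (-x) (by simpa using h0)
      omega

theorem fiber_eq (hΛ : IsLeech Λ) (c : Fin 24 → ZMod 2) :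
    ∑ x ∈ (finite_short Λ).toFinset with Λ.red x = c, wt Λ x = 48 := by
  classical
  have h := total_weight Λ hΛ
  rw [← Finset.sum_fiberwise (s := (finite_short Λ).toFinset) (g := Λ.red)] at h
  have h2 : ∑ c : Fin 24 → ZMod 2, 48 = 48 * 2 ^ 24 := by
    rw [Finset.sum_const, Finset.card_univ, Fintype.card_fun, ZMod.card, Fintype.card_fin,
      smul_eq_mul, mul_comm]
  rw [← h2] at h
  exact (Finset.sum_eq_sum_iff_of_le fun c _ => fiber_le Λ hΛ c).1 h c (Finset.mem_univ _)

theorem frame_card (hΛ : IsLeech Λ) (v : Fin 24 → ℤ) (hv : Λ.inner v v = 8) :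
    Nat.card {u | Λ.inner u u = 8 ∧ Λ.red u = Λ.red v} = 48 := by
  classical
  have h := fiber_eq Λ hΛ (Λ.red v)
  set F := (finite_short Λ).toFinset.filter fun x => Λ.red x = Λ.red v with hF
  have hm : ∀ x, x ∈ F ↔ Λ.inner x x ≤ 8 ∧ Λ.red x = Λ.red v := by
    intro x
    simp [hF]
  have h8 : ∀ x ∈ F, Λ.inner x x = 8 := by
    intro x hx
    obtain ⟨h1, h2⟩ := (hm x).1 hx
    by_cases e1 : x = v
    · rw [e1, hv]
    by_cases e2 : x = -v
    · rw [e2, Λ.inner_neg_left, Λ.inner_neg_right, hv]; rfl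
    exact (cong_lemma Λ hΛ x v h1 hv.le h2 e1 e2).1
  have : ∀ x ∈ F, wt Λ x = 1 := by
    intro x hx
    have h1 := h8 x hx
    rw [inner_eq_hnorm] at h1
    have : hnorm Λ x = 4 := by omega
    simp [wt, this]
  rw [Finset.sum_congr rfl this] at h
  simp only [Finset.sum_const, smul_eq_mul, mul_one] at h
  have hS : {u | Λ.inner u u = 8 ∧ Λ.red u = Λ.red v} = (F : Set (Fin 24 → ℤ)) := by
    ext u
    simp only [Set.mem_ofPred_eq, Finset.mem_coe, hm]
    constructor
    · rintro ⟨a, b⟩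
      exact ⟨a.le, b⟩
    · intro hu
      exact ⟨h8 u ((hm u).2 hu), hu.2⟩
  rw [hS]
  simpa using h

end Counting

section Final

theorem two_cancel {x y : Fin 24 → ℤ} (h : (2 : ℤ) • x = (2 : ℤ) • y) : x = y := by
  funext i
  have := congrFun h i
  simp only [Pi.smul_apply, smul_eq_mul] at this
  omega

/-- the element `a eᵢ + b eⱼ` of `D12`. -/
def dpair (i j : Fin 12) (a b : ℤ) (h : (2 : ℤ) ∣ a + b) : D12 :=
  ⟨Pi.single i a + Pi.single j b, by
    show (2 : ℤ) ∣ ∑ k, (Pi.single i a + Pi.single j b : Fin 12 → ℤ) k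
    simpa [Finset.sum_add_distrib] using h⟩

/-- The isometric embedding condition. -/
def IsIso2 (Λ : EvenUnimodularLattice 24) (φ : D12 →ₗ[ℤ] (Fin 24 → ℤ)) : Prop :=
  ∀ x y : D12, Λ.inner (φ x) (φ y) = 2 * ((x : Fin 12 → ℤ) ⬝ᵥ (y : Fin 12 → ℤ))

/-- frame vectors -/
def fv (φ : D12 →ₗ[ℤ] (Fin 24 → ℤ)) (i : Fin 12) : Fin 24 → ℤ := φ (dpair i i 1 1 (by norm_num))

/-- half frame attached to an embedding -/
def hf (φ : D12 →ₗ[ℤ] (Fin 24 → ℤ)) : Set (Fin 24 → ℤ) := {v | ∃ i, v = fv φ i ∨ v = -fv φ i}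

theorem two_phi (φ : D12 →ₗ[ℤ] (Fin 24 → ℤ)) (x : D12) :
    (2 : ℤ) • φ x = ∑ i, (x : Fin 12 → ℤ) i • fv φ i := by
  simp only [fv, ← map_smul, ← map_sum]
  congr 1
  apply Subtype.ext
  funext k
  simp [dpair, Finset.sum_apply, Pi.single_apply, mul_add, Finset.sum_add_distrib]
  ring

theorem two_phi_pair (φ : D12 →ₗ[ℤ] (Fin 24 → ℤ)) (i j : Fin 12) (a b : ℤ) (h : (2 : ℤ) ∣ a + b) :
    (2 : ℤ) • φ (dpair i j a b h) = a • fv φ i + b • fv φ j := by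
  rw [two_phi]
  simp [dpair, add_smul, Finset.sum_add_distrib, Pi.single_apply, ite_smul]

theorem inner_fv_phi {Λ : EvenUnimodularLattice 24} {φ : D12 →ₗ[ℤ] (Fin 24 → ℤ)} (h : IsIso2 Λ φ)
    (i : Fin 12) (x : D12) : Λ.inner (fv φ i) (φ x) = 4 * (x : Fin 12 → ℤ) i := by
  rw [fv, h]
  simp [dpair, add_dotProduct]
  ring

theorem inner_fv {Λ : EvenUnimodularLattice 24} {φ : D12 →ₗ[ℤ] (Fin 24 → ℤ)} (h : IsIso2 Λ φ)
    (i j : Fin 12) : Λ.inner (fv φ i) (fv φ j) = if i = j then 8 else 0 := by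
  rw [fv, fv, ← fv, inner_fv_phi h]
  simp only [dpair, Pi.add_apply, Pi.single_apply]
  split_ifs <;> norm_num

theorem fv_ne {Λ : EvenUnimodularLattice 24} {φ : D12 →ₗ[ℤ] (Fin 24 → ℤ)} (h : IsIso2 Λ φ)
    {i j : Fin 12} (hij : i ≠ j) : fv φ i ≠ fv φ j ∧ fv φ i ≠ -fv φ j := by
  constructor
  · intro e
    have h1 := inner_fv h i j
    rw [if_neg hij, ← e, inner_fv h, if_pos rfl] at h1
    omega
  · intro e
    have h1 := inner_fv h i j
    rw [if_neg hij, e, Λ.inner_neg_left, inner_fv h, if_pos rfl] at h1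
    omega

theorem fv_ne_neg {Λ : EvenUnimodularLattice 24} {φ : D12 →ₗ[ℤ] (Fin 24 → ℤ)} (h : IsIso2 Λ φ)
    (i : Fin 12) : fv φ i ≠ -fv φ i := by
  intro e
  have h1 := inner_fv h i i
  rw [if_pos rfl] at h1
  have h2 := h1
  rw [e, Λ.inner_neg_left, ← e, h1] at h2
  omega

theorem hf_lattice {Λ : EvenUnimodularLattice 24} {φ : D12 →ₗ[ℤ] (Fin 24 → ℤ)} (h : IsIso2 Λ φ) :
    halfSumLattice (hf φ) = LinearMap.range φ := by
  apply le_antisymm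
  · refine Submodule.span_le.2 ?_
    rintro x ⟨u, ⟨i, hu⟩, v, ⟨j, hv⟩, h1, h2, hx⟩
    have key : ∀ a b : ℤ, ∀ hab : (2 : ℤ) ∣ a + b, u = a • fv φ i → v = b • fv φ j →
        x ∈ LinearMap.range φ := by
      intro a b hab hu hv
      refine ⟨dpair i j a b hab, two_cancel ?_⟩
      rw [two_phi_pair, hx, hu, hv]
    rcases hu with hu | hu <;> rcases hv with hv | hv
    · exact key 1 1 (by norm_num) (by simpa using hu) (by simpa using hv)
    · exact key 1 (-1) (by norm_num) (by simpa using hu) (by simpa using hv)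
    · exact key (-1) 1 (by norm_num) (by simpa using hu) (by simpa using hv)
    · exact key (-1) (-1) (by norm_num) (by simpa using hu) (by simpa using hv)
  · rintro _ ⟨x, rfl⟩
    set H := halfSumLattice (hf φ) with hH
    have hplus : ∀ i j, i ≠ j → φ (dpair i j 1 1 (by norm_num)) ∈ H := by
      intro i j hij
      refine Submodule.subset_span ⟨fv φ i, ⟨i, Or.inl rfl⟩, fv φ j, ⟨j, Or.inl rfl⟩,
        (fv_ne h hij.symm).1, (fv_ne h hij.symm).2, ?_⟩
      rw [two_phi_pair, one_smul, one_smul]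
    have hminus : ∀ i j, i ≠ j → φ (dpair i j 1 (-1) (by norm_num)) ∈ H := by
      intro i j hij
      refine Submodule.subset_span ⟨fv φ i, ⟨i, Or.inl rfl⟩, -fv φ j, ⟨j, Or.inr rfl⟩,
        ?_, ?_, ?_⟩
      · intro e
        exact (fv_ne h hij).2 e.symm
      · intro e
        exact (fv_ne h hij).1 (neg_injective e).symm
      · rw [two_phi_pair, one_smul, neg_smul, one_smul]
    have hg : ∀ i, ∃ g ∈ H, (2 : ℤ) • g = fv φ i - fv φ 0 := by
      intro i
      by_cases hi : i = 0
      · exact ⟨0, H.zero_mem, by simp [hi]⟩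
      · refine ⟨_, hminus i 0 hi, ?_⟩
        rw [two_phi_pair]
        module
    choose g hgH hg using hg
    have h0 : fv φ 0 ∈ H := by
      have : fv φ 0 = φ (dpair 0 1 1 1 (by norm_num)) + φ (dpair 0 1 1 (-1) (by norm_num)) := by
        apply two_cancel
        rw [smul_add, two_phi_pair, two_phi_pair]
        module
      rw [this]
      exact H.add_mem (hplus 0 1 (by decide)) (hminus 0 1 (by decide))
    obtain ⟨s, hs⟩ : (2 : ℤ) ∣ ∑ i, (x : Fin 12 → ℤ) i := x.2
    have : φ x = ∑ i, (x : Fin 12 → ℤ) i • g i + s • fv φ 0 := by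
      apply two_cancel
      rw [two_phi, smul_add, smul_smul, ← hs, Finset.sum_smul, Finset.smul_sum,
        ← Finset.sum_add_distrib]
      refine Finset.sum_congr rfl fun i _ => ?_
      rw [smul_comm, hg]
      module
    rw [this]
    exact H.add_mem (H.sum_mem fun i _ => H.smul_mem _ (hgH i)) (H.smul_mem _ h0)

theorem int_vec_lemma (x : Fin 12 → ℤ) (h4 : x ⬝ᵥ x = 4)
    (hp : ∀ i j, i ≠ j → (2 : ℤ) ∣ x i + x j) : ∃ i, x = Pi.single i 2 ∨ x = Pi.single i (-2) := by
  have hev : ∀ i, (2 : ℤ) ∣ x i := by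
    by_contra hcon
    push Not at hcon
    obtain ⟨i, hi⟩ := hcon
    have hodd : ∀ j, 1 ≤ x j * x j := by
      intro j
      have : x j ≠ 0 := by
        intro h0
        by_cases hij : i = j
        · subst hij; simp [h0] at hi
        · have := hp i j hij
          rw [h0, add_zero] at this
          exact hi this
      have := mul_self_pos.2 this
      omega
    have : ∑ j : Fin 12, (1 : ℤ) ≤ ∑ j, x j * x j := Finset.sum_le_sum fun j _ => hodd j
    rw [dotProduct] at h4
    rw [h4] at this
    simp at this
  choose z hz using hev
  have hz1 : ∑ i, z i * z i = 1 := by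
    have : ∑ i, x i * x i = 4 * ∑ i, z i * z i := by
      rw [Finset.mul_sum]
      exact Finset.sum_congr rfl fun i _ => by rw [hz i]; ring
    rw [dotProduct] at h4
    omega
  obtain ⟨i, hi⟩ : ∃ i, z i ≠ 0 := by
    by_contra hcon
    push Not at hcon
    simp [hcon] at hz1
  rw [← Finset.add_sum_erase _ _ (Finset.mem_univ i)] at hz1
  have hnn : ∀ j ∈ Finset.univ.erase i, 0 ≤ z j * z j := fun j _ => mul_self_nonneg _
  have hpos := mul_self_pos.2 hi
  have hge := Finset.sum_nonneg hnn
  have hzero : ∑ j ∈ Finset.univ.erase i, z j * z j = 0 := by omega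
  have hzi : z i * z i = 1 := by omega
  rw [Finset.sum_eq_zero_iff_of_nonneg hnn] at hzero
  have hj : ∀ j, j ≠ i → z j = 0 := fun j hj =>
    mul_self_eq_zero.1 (hzero j (Finset.mem_erase.2 ⟨hj, Finset.mem_univ _⟩))
  refine ⟨i, ?_⟩
  rcases mul_self_eq_one_iff.1 hzi with h1 | h1
  · left
    funext j
    by_cases hji : j = i
    · subst hji; simp [hz, h1]
    · simp [hz, hj j hji, hji]
  · right
    funext j
    by_cases hji : j = i
    · subst hji; simp [hz, h1]
    · simp [hz, hj j hji, hji]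

theorem hf_char {Λ : EvenUnimodularLattice 24} {φ : D12 →ₗ[ℤ] (Fin 24 → ℤ)} (h : IsIso2 Λ φ) :
    hf φ = {v | v ∈ LinearMap.range φ ∧ Λ.inner v v = 8 ∧
      ∀ x ∈ LinearMap.range φ, (4 : ℤ) ∣ Λ.inner v x} := by
  ext v
  constructor
  · rintro ⟨i, rfl | rfl⟩
    · refine ⟨⟨_, rfl⟩, by rw [inner_fv h, if_pos rfl], ?_⟩
      rintro _ ⟨x, rfl⟩
      exact ⟨_, inner_fv_phi h i x⟩
    · refine ⟨neg_mem ⟨_, rfl⟩, by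
        rw [Λ.inner_neg_left, Λ.inner_neg_right, inner_fv h, if_pos rfl]; rfl, ?_⟩
      rintro _ ⟨x, rfl⟩
      rw [Λ.inner_neg_left, inner_fv_phi h i x]
      exact (Dvd.intro _ rfl).neg_right
  · rintro ⟨⟨x, rfl⟩, h8, hd⟩
    obtain ⟨i, hi⟩ := int_vec_lemma x (by rw [h] at h8; omega) (by
      intro i j hij
      have := hd _ ⟨dpair i j 1 1 (by norm_num), rfl⟩
      rw [h] at this
      simp [dpair, dotProduct_add] at this
      omega)
    refine ⟨i, ?_⟩
    rcases hi with hi | hi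
    · left
      apply two_cancel
      rw [two_phi, hi]
      simp [Pi.single_apply, ite_smul]
    · right
      apply two_cancel
      rw [two_phi, hi]
      simp [Pi.single_apply, ite_smul]

theorem hf_card {Λ : EvenUnimodularLattice 24} {φ : D12 →ₗ[ℤ] (Fin 24 → ℤ)} (h : IsIso2 Λ φ) :
    Nat.card (hf φ) = 24 := by
  let f : Fin 12 × Bool → (Fin 24 → ℤ) := fun p => if p.2 then fv φ p.1 else -fv φ p.1
  have hr : hf φ = Set.range f := by
    ext v
    simp only [hf, f, Set.mem_ofPred_eq, Set.mem_range, Prod.exists, Bool.exists_bool]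
    simp [eq_comm, or_comm]
  have hinj : Function.Injective f := by
    rintro ⟨i, a⟩ ⟨j, b⟩ hfe
    by_cases hij : i = j
    · subst hij
      have h1 := fv_ne_neg h i
      cases a <;> cases b <;> simp [f] at hfe ⊢
      · exact h1 hfe.symm
      · exact h1 hfe
    · exfalso
      obtain ⟨h1, h2⟩ := fv_ne h hij
      cases a <;> cases b <;> simp [f] at hfe
      · exact h1 hfe
      · exact h2 (by rw [← hfe, neg_neg])
      · exact h2 hfe
      · exact h1 hfe
  rw [hr, Nat.card_congr (Equiv.ofInjective f hinj).symm]
  simp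

theorem hf_red {Λ : EvenUnimodularLattice 24} (φ : D12 →ₗ[ℤ] (Fin 24 → ℤ)) (v : Fin 24 → ℤ)
    (hv : v ∈ hf φ) : Λ.red v = Λ.red (fv φ 0) := by
  have h1 : ∀ i, Λ.red (fv φ i) = Λ.red (fv φ 0) := by
    intro i
    refine (Λ.red_eq_iff _ _).2 ⟨φ (dpair i 0 1 (-1) (by norm_num)), ?_⟩
    rw [two_phi_pair]
    module
  obtain ⟨i, rfl | rfl⟩ := hv
  · exact h1 i
  · rw [← h1 i]
    exact (Λ.red_eq_iff _ _).2 ⟨-fv φ i, by module⟩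

theorem iso_injective {Λ : EvenUnimodularLattice 24} {φ : D12 →ₗ[ℤ] (Fin 24 → ℤ)}
    (h : IsIso2 Λ φ) : Function.Injective φ := by
  rw [injective_iff_map_eq_zero]
  intro x hx
  have h1 := h x x
  rw [hx] at h1
  simpa [EvenUnimodularLattice.inner] using h1

theorem exists_iso (Λ : EvenUnimodularLattice 24) (hΛ : IsLeech Λ) (S T : Set (Fin 24 → ℤ))
    (hST : IsHalfFrame Λ S T) : ∃ φ : D12 →ₗ[ℤ] (Fin 24 → ℤ), IsIso2 Λ φ ∧ T = hf φ := by
  classical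
  obtain ⟨⟨-, -, hS8, hSr⟩, hTS, hTn, hT24⟩ := hST
  have hfin : T.Finite := Set.finite_of_ncard_pos (by
    show 0 < Nat.card T
    omega)
  set F := hfin.toFinset with hF
  have hFm : ∀ v, v ∈ F ↔ v ∈ T := fun v => by simp [hF]
  have hFc : F.card = 24 := (Set.ncard_eq_toFinset_card T hfin).symm.trans hT24
  have hT0 : ∀ v ∈ T, v ≠ 0 := by
    rintro v hv rfl
    have := hS8 _ (hTS hv)
    simp [EvenUnimodularLattice.inner] at this
  set P := F.filter fun v => 0 < toLex v with hP
  have hPc : P.card = 12 := by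
    have h1 := Finset.card_filter_add_card_filter_not (s := F) (fun v => 0 < toLex v)
    have h2 : (F.filter fun v => ¬ 0 < toLex v) = P.image (fun v => -v) := by
      ext v
      simp only [hP, Finset.mem_filter, Finset.mem_image, hFm]
      constructor
      · rintro ⟨hv, hn⟩
        refine ⟨-v, ⟨hTn v hv, ?_⟩, neg_neg v⟩
        rw [toLex_neg]
        refine neg_pos.2 (lt_of_le_of_ne (not_lt.1 hn) ?_)
        exact hT0 v hv
      · rintro ⟨u, ⟨hu, hp⟩, rfl⟩
        refine ⟨hTn u hu, ?_⟩
        rw [toLex_neg]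
        exact (neg_neg_of_pos hp).not_gt
    rw [h2, Finset.card_image_of_injective _ neg_injective, hFc] at h1
    change P.card + P.card = 24 at h1
    omega
  let E := Finset.equivFinOfCardEq hPc
  let e : Fin 12 → (Fin 24 → ℤ) := fun i => (E.symm i).1
  have heP : ∀ i, e i ∈ P := fun i => (E.symm i).2
  have heT : ∀ i, e i ∈ T := fun i => (hFm _).1 (Finset.mem_filter.1 (heP i)).1
  have heinj : Function.Injective e := fun i j hij => E.symm.injective (Subtype.ext hij)
  have hesurj : ∀ v ∈ P, ∃ i, v = e i := fun v hv => ⟨E ⟨v, hv⟩, by simp [e]⟩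
  have hTe : T = {v | ∃ i, v = e i ∨ v = -e i} := by
    ext v
    constructor
    · intro hv
      by_cases hp : 0 < toLex v
      · obtain ⟨i, hi⟩ := hesurj v (Finset.mem_filter.2 ⟨(hFm v).2 hv, hp⟩)
        exact ⟨i, Or.inl hi⟩
      · obtain ⟨i, hi⟩ := hesurj (-v) (Finset.mem_filter.2 ⟨(hFm _).2 (hTn v hv), by
          rw [toLex_neg]
          exact neg_pos.2 (lt_of_le_of_ne (not_lt.1 hp) (hT0 v hv))⟩)
        exact ⟨i, Or.inr (by rw [← hi, neg_neg])⟩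
    · rintro ⟨i, rfl | rfl⟩
      · exact heT i
      · exact hTn _ (heT i)
  have hin : ∀ i j, Λ.inner (e i) (e j) = if i = j then 8 else 0 := by
    intro i j
    by_cases hij : i = j
    · rw [if_pos hij, hij]
      exact hS8 _ (hTS (heT j))
    · rw [if_neg hij]
      refine (cong_lemma Λ hΛ _ _ (hS8 _ (hTS (heT i))).le (hS8 _ (hTS (heT j))).le
        (hSr _ (hTS (heT i)) _ (hTS (heT j))) (fun e => hij (heinj e)) ?_).2.2
      intro h
      have h1 := (Finset.mem_filter.1 (heP i)).2
      have h2 := (Finset.mem_filter.1 (heP j)).2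
      rw [h, toLex_neg] at h1
      exact absurd h2 (not_lt.2 (neg_pos.1 h1).le)
  have hex : ∀ i, ∃ z, e i = e 0 + (2 : ℤ) • z := fun i =>
    (Λ.red_eq_iff _ _).1 (hSr _ (hTS (heT i)) _ (hTS (heT 0)))
  choose z hz using hex
  have hhalf : ∀ x : D12, ∃ y : Fin 24 → ℤ, (2 : ℤ) • y = ∑ i, (x : Fin 12 → ℤ) i • e i := by
    intro x
    obtain ⟨s, hs⟩ : (2 : ℤ) ∣ ∑ i, (x : Fin 12 → ℤ) i := x.2
    refine ⟨∑ i, (x : Fin 12 → ℤ) i • z i + s • e 0, ?_⟩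
    rw [smul_add, smul_smul, ← hs, Finset.sum_smul, Finset.smul_sum, ← Finset.sum_add_distrib]
    refine Finset.sum_congr rfl fun i _ => ?_
    conv_rhs => rw [hz i]
    module
  choose g hg using hhalf
  let φ : D12 →ₗ[ℤ] (Fin 24 → ℤ) :=
    { toFun := g
      map_add' := fun x y => two_cancel (by
        rw [smul_add, hg, hg, hg, ← Finset.sum_add_distrib]
        exact Finset.sum_congr rfl fun i _ => by simp [add_smul])
      map_smul' := fun c x => two_cancel (by
        rw [smul_comm, hg, RingHom.id_apply, hg, Finset.smul_sum]
        exact Finset.sum_congr rfl fun i _ => by simp [mul_smul]) }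
  have hφ : ∀ x, (2 : ℤ) • φ x = ∑ i, (x : Fin 12 → ℤ) i • e i := hg
  have hiso : IsIso2 Λ φ := by
    intro x y
    have h1 : Λ.inner ((2 : ℤ) • φ x) ((2 : ℤ) • φ y) = 8 * ((x : Fin 12 → ℤ) ⬝ᵥ (y : Fin 12 → ℤ)) := by
      rw [hφ, hφ]
      simp only [Λ.inner_sum_left, Λ.inner_sum_right, Λ.inner_smul_left, Λ.inner_smul_right, hin]
      simp [dotProduct, Finset.mul_sum]
      exact Finset.sum_congr rfl fun i _ => by ring
    rw [Λ.inner_smul_left, Λ.inner_smul_right] at h1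
    omega
  have hfv : ∀ i, fv φ i = e i := by
    intro i
    apply two_cancel
    rw [fv, hφ]
    rw [Finset.sum_eq_single i]
    · simp [dpair]
    · intro j _ hj
      simp [dpair, Pi.single_eq_of_ne hj]
    · simp
  refine ⟨φ, hiso, ?_⟩
  rw [hTe]
  simp only [hf, hfv]

theorem frame_class (Λ : EvenUnimodularLattice 24) (hΛ : IsLeech Λ) (S T : Set (Fin 24 → ℤ))
    (hST : IsHalfFrame Λ S T) (v : Fin 24 → ℤ) (hv : v ∈ T) :
    S = {u | Λ.inner u u = 8 ∧ Λ.red u = Λ.red v} := by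
  obtain ⟨⟨h48, -, hS8, hSr⟩, hTS, -, -⟩ := hST
  have hc := frame_card Λ hΛ v (hS8 v (hTS hv))
  refine Set.eq_of_subset_of_ncard_le (fun u hu => ⟨hS8 u hu, hSr u hu v (hTS hv)⟩) ?_
    (Set.finite_of_ncard_pos ?_)
  · show Nat.card _ ≤ Nat.card _
    rw [hc, h48]
  · show 0 < Nat.card _
    rw [hc]
    norm_num

theorem main_thm (Λ : EvenUnimodularLattice 24)
    (hΛ : IsLeech Λ) :
    (∀ S T : Set (Fin 24 → ℤ), IsHalfFrame Λ S T →
      IsD12TwoSublattice Λ (halfSumLattice T)) ∧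
    (∀ S T S' T' : Set (Fin 24 → ℤ), IsHalfFrame Λ S T → IsHalfFrame Λ S' T' →
      halfSumLattice T = halfSumLattice T' → S = S' ∧ T = T') ∧
    (∀ N : Submodule ℤ (Fin 24 → ℤ), IsD12TwoSublattice Λ N →
      ∃ S T : Set (Fin 24 → ℤ), IsHalfFrame Λ S T ∧ halfSumLattice T = N) := by
  refine ⟨?_, ?_, ?_⟩
  · intro S T h
    obtain ⟨φ, hφ, rfl⟩ := exists_iso Λ hΛ S T h
    exact ⟨φ, iso_injective hφ, (hf_lattice hφ).symm, hφ⟩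
  · intro S T S' T' h h' hL
    obtain ⟨φ, hφ, hT⟩ := exists_iso Λ hΛ S T h
    obtain ⟨ψ, hψ, hT'⟩ := exists_iso Λ hΛ S' T' h'
    have hTT : T = T' := by
      rw [hT, hT', hf_lattice hφ, hf_lattice hψ] at hL
      rw [hT, hT', hf_char hφ, hf_char hψ, hL]
    refine ⟨?_, hTT⟩
    have hv : fv φ 0 ∈ T := by
      rw [hT]
      exact ⟨0, Or.inl rfl⟩
    rw [frame_class Λ hΛ S T h _ hv, frame_class Λ hΛ S' T' h' _ (hTT ▸ hv)]
  · rintro N ⟨φ, -, rfl, hφ⟩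
    have hφ' : IsIso2 Λ φ := hφ
    have h8 : Λ.inner (fv φ 0) (fv φ 0) = 8 := by rw [inner_fv hφ', if_pos rfl]
    have hneg : ∀ v : Fin 24 → ℤ, Λ.red (-v) = Λ.red v := fun v =>
      (Λ.red_eq_iff _ _).2 ⟨-v, by module⟩
    refine ⟨{u | Λ.inner u u = 8 ∧ Λ.red u = Λ.red (fv φ 0)}, hf φ,
      ⟨⟨frame_card Λ hΛ _ h8, ?_, fun v hv => hv.1, fun v hv u hu => hv.2.trans hu.2.symm⟩,
        ?_, ?_, hf_card hφ'⟩, hf_lattice hφ'⟩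
    · rintro v ⟨h1, h2⟩
      refine ⟨?_, (hneg v).trans h2⟩
      rw [Λ.inner_neg_left, Λ.inner_neg_right, h1]
      rfl
    · intro v hv
      refine ⟨?_, hf_red φ v hv⟩
      have := hv
      rw [hf_char hφ'] at this
      exact this.2.1
    · rintro v ⟨i, rfl | rfl⟩
      · exact ⟨i, Or.inr rfl⟩
      · exact ⟨i, Or.inl (neg_neg _)⟩

end Final

/-- For the Leech lattice `Λ`, the sublattices isomorphic to
`D₁₂(2)` are in bijection with pairs consisting of a frame together with a choice of
12 of its 24 pairs, via `(S, T) ↦` the lattice generated by the `(±vᵢ ± vⱼ)/2`,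
`vᵢ, vⱼ ∈ T`. -/
theorem D12_sublattices_biject_with_frame_halves (Λ : EvenUnimodularLattice 24)
    (hΛ : IsLeech Λ) :
    (∀ S T : Set (Fin 24 → ℤ), IsHalfFrame Λ S T →
      IsD12TwoSublattice Λ (halfSumLattice T)) ∧
    (∀ S T S' T' : Set (Fin 24 → ℤ), IsHalfFrame Λ S T → IsHalfFrame Λ S' T' →
      halfSumLattice T = halfSumLattice T' → S = S' ∧ T = T') ∧
    (∀ N : Submodule ℤ (Fin 24 → ℤ), IsD12TwoSublattice Λ N →
      ∃ S T : Set (Fin 24 → ℤ), IsHalfFrame Λ S T ∧ halfSumLattice T = N) := by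
  exact main_thm Λ hΛ
end
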